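/- Let k ≥ 1 and t ≥ 3 both be odd and c ∈ {0,1}. Then an F-basis of T₁(B^{k,t}_c) = {x ∈ B^{k,t}_c : x² ∈ K(B^{k,t}_c)} is given by 𝓣 = 𝓚 ∪ {(αβγ)^{(k+1)/2}, …, (αβγ)^{k−1}} ∪ {η^{(t+1)/2}, …, η^t} ∪ 𝓝, where 𝓝 = {α} if c = 0 and 𝓝 = ∅ if c = 1. -/

import Mathlib

/- Common setup: the algebras B^{k,t}_c = SD(2B)₂^{k,t}(c) of semidihedral type,
   over a field F, presented as a quotient of the free algebra on the paths-generators
   e₁, e₂ (trivial paths), α (loop at vertex 1), β (arrow 1 → 2),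
   γ (arrow 2 → 1), η (loop at vertex 2), by the path-algebra relations
   together with Erdmann's relations  βη = (αβγ)^{k-1}αβ, γβ = η^{t-1},
   ηγ = (γαβ)^{k-1}γα, βη² = 0, η²γ = 0, α² = c(αβγ)^k. -/

noncomputable section

namespace SD2Paper

inductive Gen : Type
  | e1 | e2 | a | b | g | h

variable (F : Type) [Field F]

/-- The generators inside the free algebra. -/
def gen (t : Gen) : FreeAlgebra F Gen := FreeAlgebra.ι F t

/-- The defining relations of `D(2B)^{k,s}(c)` (paths written from left to right). -/
inductive Rel (k t : ℕ) (c : F) : FreeAlgebra F Gen → FreeAlgebra F Gen → Prop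
  | unit : Rel k t c (gen F .e1 + gen F .e2) 1
  | idem1 : Rel k t c (gen F .e1 * gen F .e1) (gen F .e1)
  | idem2 : Rel k t c (gen F .e2 * gen F .e2) (gen F .e2)
  | orth12 : Rel k t c (gen F .e1 * gen F .e2) 0
  | orth21 : Rel k t c (gen F .e2 * gen F .e1) 0
  | aL : Rel k t c (gen F .e1 * gen F .a) (gen F .a)
  | aR : Rel k t c (gen F .a * gen F .e1) (gen F .a)
  | bL : Rel k t c (gen F .e1 * gen F .b) (gen F .b)
  | bR : Rel k t c (gen F .b * gen F .e2) (gen F .b)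
  | gL : Rel k t c (gen F .e2 * gen F .g) (gen F .g)
  | gR : Rel k t c (gen F .g * gen F .e1) (gen F .g)
  | hL : Rel k t c (gen F .e2 * gen F .h) (gen F .h)
  | hR : Rel k t c (gen F .h * gen F .e2) (gen F .h)
  | bh : Rel k t c (gen F .b * gen F .h)
      ((gen F .a * gen F .b * gen F .g) ^ (k - 1) * (gen F .a * gen F .b))
  | gb : Rel k t c (gen F .g * gen F .b) ((gen F .h) ^ (t - 1))
  | hg : Rel k t c (gen F .h * gen F .g)
      ((gen F .g * gen F .a * gen F .b) ^ (k - 1) * (gen F .g * gen F .a))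
  | bh2 : Rel k t c (gen F .b * gen F .h * gen F .h) 0
  | h2g : Rel k t c (gen F .h * gen F .h * gen F .g) 0
  | asq : Rel k t c (gen F .a * gen F .a) (c • (gen F .a * gen F .b * gen F .g) ^ k)

/-- The algebra `B^{k,t}_c = SD(2B)₂^{k,t}(c)`. -/
def BA (k t : ℕ) (c : F) : Type := RingQuot (Rel F k t c)

instance (k t : ℕ) (c : F) : Ring (BA F k t c) :=
  inferInstanceAs (Ring (RingQuot (Rel F k t c)))

instance (k t : ℕ) (c : F) : Algebra F (BA F k t c) :=
  inferInstanceAs (Algebra F (RingQuot (Rel F k t c)))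

variable (k t : ℕ) (c : F)

/-- The canonical projection. -/
def mk : FreeAlgebra F Gen →ₐ[F] BA F k t c := RingQuot.mkAlgHom F (Rel F k t c)

def E1 : BA F k t c := mk F k t c (gen F .e1)
def E2 : BA F k t c := mk F k t c (gen F .e2)
/-- The image of the loop α at vertex 1. -/
def Al : BA F k t c := mk F k t c (gen F .a)
/-- The image of the arrow β : 1 → 2. -/
def Be : BA F k t c := mk F k t c (gen F .b)
/-- The image of the arrow γ : 2 → 1. -/
def Ga : BA F k t c := mk F k t c (gen F .g)
/-- The image of the loop η at vertex 2. -/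
def Et : BA F k t c := mk F k t c (gen F .h)

/-- The path αβγ. -/
def ABG : BA F k t c := Al F k t c * Be F k t c * Ga F k t c
/-- The path βγα. -/
def BGA : BA F k t c := Be F k t c * Ga F k t c * Al F k t c
/-- The path γαβ. -/
def GAB : BA F k t c := Ga F k t c * Al F k t c * Be F k t c

/-- The standard basis paths 𝓑₁₁ of e₁Ae₁. -/
def B11 : Set (BA F k t c) :=
  {E1 F k t c, Al F k t c, Be F k t c * Ga F k t c, (ABG F k t c) ^ k}
    ∪ (fun i => (ABG F k t c) ^ i) '' Set.Icc 1 (k - 1)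
    ∪ (fun i => (ABG F k t c) ^ i * Al F k t c) '' Set.Icc 1 (k - 1)
    ∪ (fun i => (BGA F k t c) ^ i) '' Set.Icc 1 (k - 1)
    ∪ (fun i => (BGA F k t c) ^ i * (Be F k t c * Ga F k t c)) '' Set.Icc 1 (k - 1)

/-- The standard basis paths 𝓑₁₂ of e₁Ae₂. -/
def B12 : Set (BA F k t c) :=
  {Be F k t c, Al F k t c * Be F k t c}
    ∪ (fun i => (BGA F k t c) ^ i * Be F k t c) '' Set.Icc 1 (k - 1)
    ∪ (fun i => (ABG F k t c) ^ i * (Al F k t c * Be F k t c)) '' Set.Icc 1 (k - 1)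

/-- The standard basis paths 𝓑₂₁ of e₂Ae₁. -/
def B21 : Set (BA F k t c) :=
  {Ga F k t c, Ga F k t c * Al F k t c}
    ∪ (fun i => (GAB F k t c) ^ i * Ga F k t c) '' Set.Icc 1 (k - 1)
    ∪ (fun i => (GAB F k t c) ^ i * (Ga F k t c * Al F k t c)) '' Set.Icc 1 (k - 1)

/-- The standard basis paths 𝓑₂₂ of e₂Ae₂. -/
def B22 : Set (BA F k t c) :=
  {E2 F k t c}
    ∪ (fun i => (GAB F k t c) ^ i) '' Set.Icc 1 (k - 1)
    ∪ (fun j => (Et F k t c) ^ j) '' Set.Icc 1 t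

/-- The standard path basis 𝓑 of `A^{k,s}_c`. -/
def BB : Set (BA F k t c) :=
  B11 F k t c ∪ B12 F k t c ∪ B21 F k t c ∪ B22 F k t c

/-- The commutator subspace K(A): the F-linear span of all commutators. -/
def Kspan (A : Type) [Ring A] [Algebra F A] : Submodule F A :=
  Submodule.span F {z : A | ∃ u v : A, z = u * v - v * u}

/-- The (left) socle of a ring: the sum of all simple (left) submodules. -/
def socle (A : Type) [Ring A] : Submodule A A := sSup {S : Submodule A A | IsAtom S}

/-- `ψ` is the linear form sending each standard basis path lying in the socle to 1
    and every other standard basis path to 0. -/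
def SoclePsi (ψ : BA F k t c →ₗ[F] F) : Prop :=
  ∀ p ∈ BB F k t c,
    (p ∈ socle (BA F k t c) → ψ p = 1) ∧ (p ∉ socle (BA F k t c) → ψ p = 0)

/-- `T₁(A) = {x : x² ∈ K(A)}`. -/
def T1set : Set (BA F k t c) := {z | z ^ 2 ∈ Kspan F (BA F k t c)}

/-- The orthogonal space `T₁(A)^⊥` with respect to the form `⟨x, y⟩ = ψ(xy)`. -/
def T1perp (ψ : BA F k t c →ₗ[F] F) : Set (BA F k t c) :=
  {y | ∀ x ∈ T1set F k t c, ψ (y * x) = 0}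

/-- The first generalized Reynolds ideal, as an ideal of the center `Z(A)`. -/
def ReynoldsIdeal (ψ : BA F k t c →ₗ[F] F) :
    Ideal (Subalgebra.center F (BA F k t c)) :=
  Ideal.span {z : Subalgebra.center F (BA F k t c) | (z : BA F k t c) ∈ T1perp F k t c ψ}


/-- The set 𝓚₁₁ (semidihedral type, second family). -/
def K11 : Set (BA F k t c) :=
  {Be F k t c * Ga F k t c + Ga F k t c * Be F k t c}
    ∪ (fun i => (ABG F k t c) ^ i + (BGA F k t c) ^ i) '' Set.Icc 1 (k - 1)
    ∪ (fun i => (ABG F k t c) ^ i * Al F k t c) '' Set.Icc 1 (k - 1)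
    ∪ (fun i => (BGA F k t c) ^ i * (Be F k t c * Ga F k t c)) '' Set.Icc 1 (k - 1)

/-- The set 𝓚₂₂ (semidihedral type, second family). -/
def K22 : Set (BA F k t c) :=
  (fun i => (ABG F k t c) ^ i + (GAB F k t c) ^ i) '' Set.Icc 1 k

/-- The set 𝓚 = 𝓑₁₂ ∪ 𝓑₂₁ ∪ 𝓚₁₁ ∪ 𝓚₂₂, a basis of the commutator subspace. -/
def KK : Set (BA F k t c) :=
  B12 F k t c ∪ B21 F k t c ∪ K11 F k t c ∪ K22 F k t c

open Classical in
/-- The set 𝓝 of Lemma 5.3. -/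
def NN : Set (BA F k t c) := if c = 0 then {Al F k t c} else ∅

/-- The set 𝓣 of Lemma 5.3:
`𝓣 = 𝓚 ∪ {(αβγ)^{(k+1)/2}, …, (αβγ)^{k-1}} ∪ {η^{(t+1)/2}, …, η^t} ∪ 𝓝`. -/
def TT : Set (BA F k t c) :=
  KK F k t c
    ∪ (fun i => (ABG F k t c) ^ i) '' Set.Icc ((k + 1) / 2) (k - 1)
    ∪ (fun j => (Et F k t c) ^ j) '' Set.Icc ((t + 1) / 2) t
    ∪ NN F k t c

open Finsupp

section Relations

variable {F k t c}

lemma mk_eq_of_rel {x y : FreeAlgebra F Gen} (h : Rel F k t c x y) :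
    mk F k t c x = mk F k t c y :=
  RingQuot.mkAlgHom_rel F h

lemma E1_add_E2 : E1 F k t c + E2 F k t c = 1 := by
  have h := mk_eq_of_rel (Rel.unit (F := F) (k := k) (t := t) (c := c))
  simp only [map_add, map_one] at h
  exact h

lemma E1_mul_E1 : E1 F k t c * E1 F k t c = E1 F k t c := by
  have h := mk_eq_of_rel (Rel.idem1 (F := F) (k := k) (t := t) (c := c))
  simp only [map_mul] at h
  exact h

lemma E2_mul_E2 : E2 F k t c * E2 F k t c = E2 F k t c := by
  have h := mk_eq_of_rel (Rel.idem2 (F := F) (k := k) (t := t) (c := c))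
  simp only [map_mul] at h
  exact h

lemma E1_mul_E2 : E1 F k t c * E2 F k t c = 0 := by
  have h := mk_eq_of_rel (Rel.orth12 (F := F) (k := k) (t := t) (c := c))
  simp only [map_mul, map_zero] at h
  exact h

lemma E2_mul_E1 : E2 F k t c * E1 F k t c = 0 := by
  have h := mk_eq_of_rel (Rel.orth21 (F := F) (k := k) (t := t) (c := c))
  simp only [map_mul, map_zero] at h
  exact h

lemma E1_mul_Al : E1 F k t c * Al F k t c = Al F k t c := by
  have h := mk_eq_of_rel (Rel.aL (F := F) (k := k) (t := t) (c := c))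
  simp only [map_mul] at h
  exact h

lemma Al_mul_E1 : Al F k t c * E1 F k t c = Al F k t c := by
  have h := mk_eq_of_rel (Rel.aR (F := F) (k := k) (t := t) (c := c))
  simp only [map_mul] at h
  exact h

lemma E1_mul_Be : E1 F k t c * Be F k t c = Be F k t c := by
  have h := mk_eq_of_rel (Rel.bL (F := F) (k := k) (t := t) (c := c))
  simp only [map_mul] at h
  exact h

lemma Be_mul_E2 : Be F k t c * E2 F k t c = Be F k t c := by
  have h := mk_eq_of_rel (Rel.bR (F := F) (k := k) (t := t) (c := c))
  simp only [map_mul] at h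
  exact h

lemma E2_mul_Ga : E2 F k t c * Ga F k t c = Ga F k t c := by
  have h := mk_eq_of_rel (Rel.gL (F := F) (k := k) (t := t) (c := c))
  simp only [map_mul] at h
  exact h

lemma Ga_mul_E1 : Ga F k t c * E1 F k t c = Ga F k t c := by
  have h := mk_eq_of_rel (Rel.gR (F := F) (k := k) (t := t) (c := c))
  simp only [map_mul] at h
  exact h

lemma E2_mul_Et : E2 F k t c * Et F k t c = Et F k t c := by
  have h := mk_eq_of_rel (Rel.hL (F := F) (k := k) (t := t) (c := c))
  simp only [map_mul] at h
  exact h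

lemma Et_mul_E2 : Et F k t c * E2 F k t c = Et F k t c := by
  have h := mk_eq_of_rel (Rel.hR (F := F) (k := k) (t := t) (c := c))
  simp only [map_mul] at h
  exact h

lemma Be_mul_Et : Be F k t c * Et F k t c =
    ABG F k t c ^ (k - 1) * (Al F k t c * Be F k t c) := by
  have h := mk_eq_of_rel (Rel.bh (F := F) (k := k) (t := t) (c := c))
  simp only [map_mul, map_pow] at h
  exact h

lemma Ga_mul_Be : Ga F k t c * Be F k t c = Et F k t c ^ (t - 1) := by
  have h := mk_eq_of_rel (Rel.gb (F := F) (k := k) (t := t) (c := c))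
  simp only [map_mul, map_pow] at h
  exact h

lemma Et_mul_Ga : Et F k t c * Ga F k t c =
    GAB F k t c ^ (k - 1) * (Ga F k t c * Al F k t c) := by
  have h := mk_eq_of_rel (Rel.hg (F := F) (k := k) (t := t) (c := c))
  simp only [map_mul, map_pow] at h
  exact h

lemma Be_mul_Et_mul_Et : Be F k t c * Et F k t c * Et F k t c = 0 := by
  have h := mk_eq_of_rel (Rel.bh2 (F := F) (k := k) (t := t) (c := c))
  simp only [map_mul, map_zero] at h
  exact h

lemma Et_mul_Et_mul_Ga : Et F k t c * Et F k t c * Ga F k t c = 0 := by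
  have h := mk_eq_of_rel (Rel.h2g (F := F) (k := k) (t := t) (c := c))
  simp only [map_mul, map_zero] at h
  exact h

lemma Al_mul_Al : Al F k t c * Al F k t c = c • ABG F k t c ^ k := by
  have h := mk_eq_of_rel (Rel.asq (F := F) (k := k) (t := t) (c := c))
  simp only [map_mul, map_pow, map_smul] at h
  exact h

end Relations

section Paths


/-- The arrow of the cycle `α, β, γ` leaving the position `s` (read modulo 3). -/
def arrow (s : ℕ) : BA F k t c :=
  if s % 3 = 0 then Al F k t c else if s % 3 = 1 then Be F k t c else Ga F k t c

/-- The trivial path at the vertex reached at position `s` of the cycle `α, β, γ`. -/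
def triv (s : ℕ) : BA F k t c := if s % 3 = 2 then E2 F k t c else E1 F k t c

/-- The path of length `n` along the cycle `α, β, γ` that starts at position `s`. -/
def cyclePath : ℕ → ℕ → BA F k t c
  | 0, s => triv F k t c s
  | n + 1, s => arrow F k t c s * cyclePath n (s + 1)

/-- The path `η ^ j` at the second vertex, which for `j = 0` is the trivial path. -/
def loopPath (j : ℕ) : BA F k t c := E2 F k t c * Et F k t c ^ j

end Paths

section PathLemmas

variable {F k t c}

local notation "ar" => arrow F k t c
local notation "ε" => triv F k t c
local notation "P" => cyclePath F k t c
local notation "η" => Et F k t c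

lemma arrow_congr {s r : ℕ} (h : s % 3 = r % 3) : ar s = ar r := by simp only [arrow, h]

lemma triv_congr {s r : ℕ} (h : s % 3 = r % 3) : ε s = ε r := by simp only [triv, h]

lemma cyclePath_congr {s r : ℕ} (n : ℕ) (h : s % 3 = r % 3) : P n s = P n r := by
  induction n generalizing s r with
  | zero => exact triv_congr h
  | succ n ih => rw [cyclePath, cyclePath, arrow_congr h, ih (by omega : (s + 1) % 3 = (r + 1) % 3)]

lemma arrow_zero : ar 0 = Al F k t c := rfl
lemma arrow_one : ar 1 = Be F k t c := rfl
lemma arrow_two : ar 2 = Ga F k t c := rfl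

lemma triv_mul_self (s : ℕ) : ε s * ε s = ε s := by
  unfold triv; split_ifs
  exacts [E2_mul_E2, E1_mul_E1]

lemma triv_mul_triv {s r : ℕ} (h : ¬ (s % 3 = 2 ↔ r % 3 = 2)) : ε s * ε r = 0 := by
  unfold triv; split_ifs <;> first | exact E1_mul_E2 | exact E2_mul_E1 | (exfalso; tauto)

lemma triv_mul_arrow (s : ℕ) : ε s * ar s = ar s := by
  unfold triv arrow; split_ifs <;>
    first | exact E1_mul_Al | exact E1_mul_Be | exact E2_mul_Ga | (exfalso; omega)

lemma arrow_mul_triv (s : ℕ) : ar s * ε (s + 1) = ar s := by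
  unfold triv arrow; split_ifs <;>
    first | exact Al_mul_E1 | exact Be_mul_E2 | exact Ga_mul_E1 | (exfalso; omega)

lemma triv_mul_cyclePath (n s : ℕ) : ε s * P n s = P n s := by
  cases n with
  | zero => exact triv_mul_self s
  | succ n => rw [cyclePath, ← mul_assoc, triv_mul_arrow]

lemma cyclePath_mul_triv (n s : ℕ) : P n s * ε (s + n) = P n s := by
  induction n generalizing s with
  | zero => exact triv_mul_self s
  | succ n ih => rw [cyclePath, mul_assoc, show s + (n + 1) = s + 1 + n by omega, ih]

lemma cyclePath_one (s : ℕ) : P 1 s = ar s := arrow_mul_triv s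

lemma cyclePath_mul_cyclePath (n m : ℕ) {s r : ℕ} (h : r % 3 = (s + n) % 3) :
    P n s * P m r = P (n + m) s := by
  rw [cyclePath_congr m h]
  clear h
  induction n generalizing s with
  | zero => rw [cyclePath, Nat.add_zero, triv_mul_cyclePath, Nat.zero_add]
  | succ n ih =>
    rw [cyclePath, mul_assoc, show s + (n + 1) = s + 1 + n by omega, ih,
      show n + 1 + m = n + m + 1 by omega, cyclePath]

lemma arrow_mul_cyclePath (n : ℕ) {s r : ℕ} (h : s % 3 = (r + 1) % 3) :
    ar r * P n s = P (n + 1) r := by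
  rw [cyclePath, cyclePath_congr n h]

lemma cyclePath_mul_arrow (n : ℕ) {s r : ℕ} (h : r % 3 = (s + n) % 3) :
    P n s * ar r = P (n + 1) s := by
  rw [← cyclePath_one, cyclePath_mul_cyclePath n 1 h]

/-- Products of paths that do not meet at a common vertex vanish. -/
lemma cyclePath_mul_cyclePath_eq_zero (n m : ℕ) {s r : ℕ} (h : ¬ ((s + n) % 3 = 2 ↔ r % 3 = 2)) :
    P n s * P m r = 0 := by
  rw [← cyclePath_mul_triv n s, ← triv_mul_cyclePath m r, mul_assoc, ← mul_assoc (ε (s + n)),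
    triv_mul_triv h, zero_mul, mul_zero]

lemma ABG_eq : ABG F k t c = P 3 0 := by
  rw [ABG, ← arrow_zero, ← arrow_one, ← arrow_two, ← cyclePath_one 0, cyclePath_mul_arrow 1 rfl,
    cyclePath_mul_arrow 2 rfl]

lemma BGA_eq : BGA F k t c = P 3 1 := by
  rw [BGA, ← arrow_zero, ← arrow_one, ← arrow_two, ← cyclePath_one 1,
    cyclePath_mul_arrow (r := 2) 1 rfl, cyclePath_mul_arrow (r := 0) (1 + 1) rfl]

lemma GAB_eq : GAB F k t c = P 3 2 := by
  rw [GAB, ← arrow_zero, ← arrow_one, ← arrow_two, ← cyclePath_one 2,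
    cyclePath_mul_arrow (r := 0) 1 rfl, cyclePath_mul_arrow (r := 1) (1 + 1) rfl]

lemma cyclePath_three_pow (s i : ℕ) (hi : 1 ≤ i) : P 3 s ^ i = P (3 * i) s := by
  induction i, hi using Nat.le_induction with
  | base => simp
  | succ i _ ih => rw [pow_succ, ih, cyclePath_mul_cyclePath _ _ (by omega), Nat.mul_succ]

lemma cyclePath_three_pow_mul (i n : ℕ) {s : ℕ} : P 3 s ^ i * P n s = P (3 * i + n) s := by
  induction i with
  | zero => simp
  | succ i ih =>
    rw [pow_succ', mul_assoc, ih, cyclePath_mul_cyclePath _ _ (by omega)]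
    congr 1; omega

lemma arrow_mul_arrow (s : ℕ) : ar s * ar (s + 1) = P 2 s := by
  rw [← cyclePath_one (s + 1), arrow_mul_cyclePath 1 rfl]

lemma Al_mul_Al' (hk : 1 ≤ k) : Al F k t c * Al F k t c = c • P (3 * k) 0 := by
  rw [Al_mul_Al, ABG_eq, cyclePath_three_pow _ _ hk]

lemma Be_mul_Et' (hk : 1 ≤ k) : Be F k t c * η = P (3 * k - 1) 0 := by
  rw [Be_mul_Et, ABG_eq, ← arrow_zero, ← arrow_one, arrow_mul_arrow 0, cyclePath_three_pow_mul]
  congr 1; omega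

lemma Et_mul_Ga' (hk : 1 ≤ k) : η * Ga F k t c = P (3 * k - 1) 2 := by
  rw [Et_mul_Ga, GAB_eq, ← arrow_zero, ← arrow_two, arrow_congr (show 0 % 3 = (2 + 1) % 3 from rfl),
    arrow_mul_arrow 2, cyclePath_three_pow_mul]
  congr 1; omega

lemma Be_mul_Et_pow {j : ℕ} (hj : 2 ≤ j) : Be F k t c * η ^ j = 0 := by
  obtain ⟨j, rfl⟩ := Nat.exists_eq_add_of_le hj
  rw [pow_add, pow_two, ← mul_assoc, ← mul_assoc, Be_mul_Et_mul_Et, zero_mul]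

lemma Et_pow_mul_Ga {j : ℕ} (hj : 2 ≤ j) : η ^ j * Ga F k t c = 0 := by
  obtain ⟨j, rfl⟩ := Nat.exists_eq_add_of_le' hj
  rw [pow_add, pow_two, mul_assoc, Et_mul_Et_mul_Ga, mul_zero]

lemma Be_mul_Ga_mul_Be (ht : 3 ≤ t) : Be F k t c * (Ga F k t c * Be F k t c) = 0 := by
  rw [Ga_mul_Be, Be_mul_Et_pow (by omega)]

lemma Ga_mul_Be_mul_Ga (ht : 3 ≤ t) : Ga F k t c * Be F k t c * Ga F k t c = 0 := by
  rw [Ga_mul_Be, Et_pow_mul_Ga (by omega)]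

lemma cyclePath_socle_one (hk : 1 ≤ k) : P (3 * k) 1 = P (3 * k) 0 := by
  have h : Be F k t c * η * Ga F k t c = Be F k t c * (η * Ga F k t c) := mul_assoc _ _ _
  rw [Be_mul_Et' hk, Et_mul_Ga' hk, ← arrow_two, ← arrow_one, cyclePath_mul_arrow _ (by omega),
    arrow_mul_cyclePath _ (by omega), Nat.sub_add_cancel (by omega)] at h
  exact h.symm

lemma cyclePath_socle_two (hk : 1 ≤ k) (ht : 3 ≤ t) : P (3 * k) 2 = η ^ t := by
  have h : Ga F k t c * Be F k t c * η = Ga F k t c * (Be F k t c * η) := mul_assoc _ _ _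
  rw [Be_mul_Et' hk, Ga_mul_Be, ← arrow_two, ← pow_succ,
    arrow_mul_cyclePath _ (by omega), Nat.sub_add_cancel (by omega),
    Nat.sub_add_cancel (by omega)] at h
  exact h.symm

lemma cyclePath_eq_zero_of_prefix {n m : ℕ} {s : ℕ} (h : P n s = 0) (hm : n ≤ m) : P m s = 0 := by
  obtain ⟨d, rfl⟩ := Nat.exists_eq_add_of_le hm
  rw [← cyclePath_mul_cyclePath n d rfl, h, zero_mul]

lemma cyclePath_eq_zero (hk : 1 ≤ k) (ht : 3 ≤ t) {n : ℕ} (s : ℕ) (hn : 3 * k < n) :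
    P n s = 0 := by
  have h2 : P (3 * k + 1) 2 = 0 := by
    rw [← arrow_mul_cyclePath (3 * k) (show 0 % 3 = (2 + 1) % 3 from rfl), ← cyclePath_socle_one hk,
      show 3 * k = 2 + (3 * k - 2) by omega,
      ← cyclePath_mul_cyclePath 2 (3 * k - 2) (rfl : 0 % 3 = (1 + 2) % 3), ← arrow_mul_arrow 1,
      ← mul_assoc, ← mul_assoc]
    change Ga F k t c * Be F k t c * Ga F k t c * _ = 0
    rw [Ga_mul_Be_mul_Ga ht, zero_mul]
  have h1 : P (3 * k + 1) 1 = 0 := by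
    rw [← arrow_mul_cyclePath (3 * k) (show 2 % 3 = (1 + 1) % 3 from rfl),
      cyclePath_socle_two hk ht]
    exact Be_mul_Et_pow (by omega)
  have h0 : P (3 * k + 1) 0 = 0 := by
    rw [← arrow_mul_cyclePath (3 * k) (show 1 % 3 = (0 + 1) % 3 from rfl), cyclePath_socle_one hk,
      show P (3 * k) 0 = ar 0 * P (3 * k - 1) 1 by
        rw [arrow_mul_cyclePath _ rfl, Nat.sub_add_cancel (by omega)], ← mul_assoc, arrow_zero,
      Al_mul_Al' hk, smul_mul_assoc, ← cyclePath_socle_one hk,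
      cyclePath_mul_cyclePath _ _ (by omega), cyclePath_eq_zero_of_prefix h1 (by omega), smul_zero]
  have h3 : s % 3 = 0 % 3 ∨ s % 3 = 1 % 3 ∨ s % 3 = 2 % 3 := by omega
  rcases h3 with h | h | h
  · rw [cyclePath_congr n h]
    exact cyclePath_eq_zero_of_prefix h0 hn
  · rw [cyclePath_congr n h]
    exact cyclePath_eq_zero_of_prefix h1 hn
  · rw [cyclePath_congr n h]
    exact cyclePath_eq_zero_of_prefix h2 hn

lemma arrow_mul_arrow_eq_zero {r s : ℕ} (h : s % 3 ≠ (r + 1) % 3)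
    (h0 : ¬ (r % 3 = 0 ∧ s % 3 = 0)) (h1 : ¬ (r % 3 = 2 ∧ s % 3 = 1)) : ar r * ar s = 0 := by
  rw [← cyclePath_one, ← cyclePath_one, cyclePath_mul_cyclePath_eq_zero]
  omega

/-- A non-consecutive arrow annihilates paths of length at least two from the left. -/
lemma arrow_mul_cyclePath_eq_zero (hk : 1 ≤ k) (ht : 3 ≤ t) {r s n : ℕ}
    (h : s % 3 ≠ (r + 1) % 3) (hn : 2 ≤ n) : ar r * P n s = 0 := by
  obtain ⟨n, rfl⟩ := Nat.exists_eq_add_of_le hn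
  rw [← cyclePath_mul_cyclePath 2 n rfl, ← arrow_mul_arrow]
  by_cases h0 : r % 3 = 0 ∧ s % 3 = 0
  · rw [arrow_congr (show r % 3 = 0 % 3 from h0.1), arrow_congr (show s % 3 = 0 % 3 from h0.2),
      ← mul_assoc, ← mul_assoc, arrow_zero, Al_mul_Al' hk, smul_mul_assoc,
      ← cyclePath_socle_one hk, cyclePath_mul_arrow _ (by omega), cyclePath_eq_zero hk ht 1
        (by omega), smul_zero, zero_mul]
  by_cases h1 : r % 3 = 2 ∧ s % 3 = 1
  · rw [arrow_congr (show r % 3 = 2 % 3 from h1.1), arrow_congr (show s % 3 = 1 % 3 from h1.2),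
      arrow_congr (show (s + 1) % 3 = 2 % 3 by omega), ← mul_assoc, ← mul_assoc, arrow_one,
      arrow_two, Ga_mul_Be_mul_Ga ht, zero_mul]
  rw [← mul_assoc, ← mul_assoc, arrow_mul_arrow_eq_zero h h0 h1, zero_mul, zero_mul]

/-- A non-consecutive arrow annihilates paths of length at least two from the right. -/
lemma cyclePath_mul_arrow_eq_zero (hk : 1 ≤ k) (ht : 3 ≤ t) {r s n : ℕ}
    (h : r % 3 ≠ (s + n) % 3) (hn : 2 ≤ n) : P n s * ar r = 0 := by
  obtain ⟨n, rfl⟩ := Nat.exists_eq_add_of_le' hn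
  rw [← cyclePath_mul_cyclePath n 2 rfl, ← arrow_mul_arrow, mul_assoc, mul_assoc]
  by_cases h0 : (s + n + 1) % 3 = 0 ∧ r % 3 = 0
  · rw [arrow_congr (show r % 3 = 0 % 3 from h0.2), arrow_congr (show (s + n + 1) % 3 = 0 % 3 from
      h0.1), arrow_zero, Al_mul_Al' hk, mul_smul_comm,
      arrow_mul_cyclePath _ (by omega), cyclePath_eq_zero (n := 3 * k + 1) hk ht _
        (by omega), smul_zero, mul_zero]
  by_cases h1 : (s + n + 1) % 3 = 2 ∧ r % 3 = 1
  · rw [arrow_congr (show r % 3 = 1 % 3 from h1.2), arrow_congr (show (s + n + 1) % 3 = 2 % 3 from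
      h1.1), arrow_congr (show (s + n) % 3 = 1 % 3 by omega), arrow_one,
      arrow_two, Be_mul_Ga_mul_Be ht, mul_zero]
  rw [arrow_mul_arrow_eq_zero (by omega) h0 h1, mul_zero, mul_zero]

lemma Et_mul_triv {s : ℕ} (h : s % 3 ≠ 2) : η * ε s = 0 := by
  rw [triv, if_neg h, ← Et_mul_E2, mul_assoc, E2_mul_E1, mul_zero]

lemma triv_mul_Et {s : ℕ} (h : s % 3 ≠ 2) : ε s * η = 0 := by
  rw [triv, if_neg h, ← E2_mul_Et, ← mul_assoc, E1_mul_E2, zero_mul]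

lemma Et_mul_cyclePath_of_ne {s : ℕ} (n : ℕ) (h : s % 3 ≠ 2) : η * P n s = 0 := by
  rw [← triv_mul_cyclePath, ← mul_assoc, Et_mul_triv h, zero_mul]

lemma cyclePath_mul_Et_of_ne {n s : ℕ} (h : (s + n) % 3 ≠ 2) : P n s * η = 0 := by
  rw [← cyclePath_mul_triv, mul_assoc, triv_mul_Et h, mul_zero]

lemma Et_mul_cyclePath_eq_zero (hk : 1 ≤ k) (ht : 3 ≤ t) {n : ℕ} (s : ℕ) (hn : 2 ≤ n) :
    η * P n s = 0 := by
  by_cases h : s % 3 = 2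
  · obtain ⟨n, rfl⟩ := Nat.exists_eq_add_of_le' hn
    rw [cyclePath_congr _ (show s % 3 = 2 % 3 from h), cyclePath, arrow_two, ← mul_assoc,
      Et_mul_Ga' hk, cyclePath, ← mul_assoc, cyclePath_mul_arrow_eq_zero hk ht (by omega) (by omega),
      zero_mul]
  · exact Et_mul_cyclePath_of_ne n h

lemma cyclePath_mul_Et_eq_zero (hk : 1 ≤ k) (ht : 3 ≤ t) {n : ℕ} (s : ℕ) (hn : 2 ≤ n) :
    P n s * η = 0 := by
  by_cases h : (s + n) % 3 = 2
  · obtain ⟨n, rfl⟩ := Nat.exists_eq_add_of_le' hn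
    rw [← cyclePath_mul_arrow (n + 1) (show 1 % 3 = (s + (n + 1)) % 3 by omega), arrow_one,
      mul_assoc, Be_mul_Et' hk, ← cyclePath_mul_arrow n rfl, mul_assoc,
      arrow_mul_cyclePath_eq_zero hk ht (by omega) (by omega), mul_zero]
  · exact cyclePath_mul_Et_of_ne h

lemma loopPath_of_pos {j : ℕ} (hj : 1 ≤ j) : loopPath F k t c j = η ^ j := by
  obtain ⟨j, rfl⟩ := Nat.exists_eq_add_of_le' hj
  rw [loopPath, pow_succ', ← mul_assoc, E2_mul_Et]

lemma Et_mul_loopPath (j : ℕ) : η * loopPath F k t c j = loopPath F k t c (j + 1) := by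
  rw [loopPath_of_pos (j := j + 1) (by omega), loopPath, ← mul_assoc, Et_mul_E2, pow_succ']

lemma Et_pow_eq_zero (hk : 1 ≤ k) (ht : 3 ≤ t) {j : ℕ} (hj : t < j) : η ^ j = 0 := by
  obtain ⟨j, rfl⟩ := Nat.exists_eq_add_of_le hj
  rw [pow_add, pow_succ, ← cyclePath_socle_two hk ht, cyclePath_mul_Et_eq_zero hk ht _ (by omega),
    zero_mul]

end PathLemmas

section Model

/-- Indices for a basis of the algebra: `cyc s n` stands for the path of length `n` along the cycle
that starts at position `s`, and `loop j` for `η ^ j`. -/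
inductive PathIndex : Type
  | cyc (s n : ℕ)
  | loop (j : ℕ)

open PathIndex

/-- The vector of the model space representing a path along the cycle. -/
def cycleVec (s n : ℕ) : PathIndex →₀ F :=
  if n = 0 then (if s % 3 = 2 then single (loop 0) 1 else single (cyc 0 0) 1)
  else if n < 3 * k then single (cyc (s % 3) n) 1
  else if n = 3 * k then (if s % 3 = 2 then single (loop t) 1 else single (cyc 0 n) 1)
  else 0

/-- The vector of the model space representing a power of `η`. -/
def loopVec (j : ℕ) : PathIndex →₀ F := if j ≤ t then single (loop j) 1 else 0

/-- Left multiplication by the first idempotent. -/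
def opE1 : (PathIndex →₀ F) →ₗ[F] (PathIndex →₀ F) :=
  linearCombination F fun
    | cyc s n => if s = 2 then 0 else single (cyc s n) 1
    | loop _ => 0

/-- Left multiplication by the second idempotent. -/
def opE2 : (PathIndex →₀ F) →ₗ[F] (PathIndex →₀ F) :=
  linearCombination F fun
    | cyc s n => if s = 2 then single (cyc s n) 1 else 0
    | loop j => single (loop j) 1

/-- Left multiplication by `α`. -/
def opAl : (PathIndex →₀ F) →ₗ[F] (PathIndex →₀ F) :=
  linearCombination F fun
    | cyc s n =>
      if s = 1 ∧ 1 ≤ n ∨ s = 0 ∧ n = 0 then cycleVec F k t 0 (n + 1)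
      else if s = 0 ∧ n = 1 then c • cycleVec F k t 0 (3 * k) else 0
    | loop _ => 0

/-- Left multiplication by `β`. -/
def opBe : (PathIndex →₀ F) →ₗ[F] (PathIndex →₀ F) :=
  linearCombination F fun
    | cyc s n => if s = 2 ∧ 1 ≤ n then cycleVec F k t 1 (n + 1) else 0
    | loop j =>
      if j = 0 then cycleVec F k t 1 1 else if j = 1 then cycleVec F k t 0 (3 * k - 1) else 0

/-- Left multiplication by `γ`. -/
def opGa : (PathIndex →₀ F) →ₗ[F] (PathIndex →₀ F) :=
  linearCombination F fun
    | cyc s n =>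
      if s = 0 then cycleVec F k t 2 (n + 1)
      else if s = 1 ∧ n = 1 then loopVec F t (t - 1) else 0
    | loop _ => 0

/-- Left multiplication by `η`. -/
def opEt : (PathIndex →₀ F) →ₗ[F] (PathIndex →₀ F) :=
  linearCombination F fun
    | cyc s n => if s = 2 ∧ n = 1 then cycleVec F k t 2 (3 * k - 1) else 0
    | loop j => loopVec F t (j + 1)

variable {F k t c}

local notation "cv" => cycleVec F k t
local notation "lv" => loopVec F t

lemma cycleVec_eq_zero {s n : ℕ} (h : 3 * k < n) : cv s n = 0 := by
  rw [cycleVec, if_neg (by omega), if_neg (by omega), if_neg (by omega)]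

lemma cycleVec_congr {s r : ℕ} (n : ℕ) (h : s % 3 = r % 3) : cv s n = cv r n := by
  simp only [cycleVec, h]

lemma loopVec_eq_zero {j : ℕ} (h : t < j) : lv j = 0 := if_neg (by omega)

lemma cycleVec_socle_one (hk : 1 ≤ k) : cv 1 (3 * k) = cv 0 (3 * k) := by
  simp [cycleVec]

lemma cycleVec_socle_two (hk : 1 ≤ k) : cv 2 (3 * k) = lv t := by
  simp [cycleVec, loopVec]; omega

/-- The value of a linear map on `cycleVec` is determined by its values on basis vectors. -/
lemma map_cycleVec_eq {W : Type} [AddCommMonoid W] [Module F W] (f : (PathIndex →₀ F) →ₗ[F] W)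
    {s n : ℕ} (hs : s < 3) {w : W} (h0 : n = 0 → s ≠ 2 → f (single (cyc 0 0) 1) = w)
    (h1 : n = 0 → s = 2 → f (single (loop 0) 1) = w)
    (h2 : 1 ≤ n → n < 3 * k → f (single (cyc s n) 1) = w)
    (h3 : 1 ≤ n → n = 3 * k → s ≠ 2 → f (single (cyc 0 n) 1) = w)
    (h4 : 1 ≤ n → n = 3 * k → s = 2 → f (single (loop t) 1) = w)
    (h5 : 1 ≤ n → 3 * k < n → w = 0) : f (cv s n) = w := by
  rw [cycleVec, Nat.mod_eq_of_lt hs]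
  split_ifs with h h' h' h' h''
  · exact h1 h h'
  · exact h0 h h'
  · exact h2 (by omega) h'
  · exact h4 (by omega) h' h''
  · exact h3 (by omega) h' h''
  · rw [map_zero, h5 (by omega) (by omega)]

lemma opAl_cycleVec_one (hk : 1 ≤ k) (n : ℕ) : opAl F k t c (cv 1 n) = cv 0 (n + 1) := by
  refine map_cycleVec_eq _ (by omega) ?_ ?_ ?_ ?_ ?_ fun _ _ ↦ cycleVec_eq_zero (by omega) <;>
    intros <;> simp_all [opAl, cycleVec_eq_zero]

lemma opAl_cycleVec_zero_one (hk : 1 ≤ k) : opAl F k t c (cv 0 1) = c • cv 0 (3 * k) := by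
  apply map_cycleVec_eq _ (by omega) <;> intros <;> simp_all [opAl]; omega

lemma opAl_cycleVec_zero (hk : 1 ≤ k) {n : ℕ} (hn : 2 ≤ n) : opAl F k t c (cv 0 n) = 0 := by
  refine map_cycleVec_eq _ (by omega) ?_ ?_ ?_ ?_ ?_ fun _ _ ↦ rfl <;>
    intros <;> simp_all [opAl, show n ≠ 0 by omega, show n ≠ 1 by omega] <;> omega

lemma opBe_cycleVec_two (ht : 3 ≤ t) (n : ℕ) : opBe F k t (cv 2 n) = cv 1 (n + 1) := by
  refine map_cycleVec_eq _ (by omega) ?_ ?_ ?_ ?_ ?_ fun _ _ ↦ cycleVec_eq_zero (by omega) <;>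
    intros <;> simp_all [opBe, cycleVec_eq_zero]
  rw [if_neg (by omega), if_neg (by omega)]

lemma opBe_loopVec {j : ℕ} (hj : 2 ≤ j) : opBe F k t (lv j) = 0 := by
  rw [loopVec]; split_ifs <;> simp [opBe, show j ≠ 0 by omega, show j ≠ 1 by omega]

lemma opBe_loopVec_one (ht : 3 ≤ t) : opBe F k t (lv 1) = cv 0 (3 * k - 1) := by
  rw [loopVec, if_pos (by omega)]; simp [opBe]

lemma opGa_cycleVec_zero (hk : 1 ≤ k) (n : ℕ) : opGa F k t (cv 0 n) = cv 2 (n + 1) := by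
  refine map_cycleVec_eq _ (by omega) ?_ ?_ ?_ ?_ ?_ fun _ _ ↦ cycleVec_eq_zero (by omega) <;>
    intros <;> simp_all [opGa, cycleVec_eq_zero]

lemma opGa_cycleVec_one (hk : 1 ≤ k) {n : ℕ} (hn : 2 ≤ n) : opGa F k t (cv 1 n) = 0 := by
  apply map_cycleVec_eq _ (by omega) <;> intros <;> simp_all [opGa, cycleVec_eq_zero] <;> omega

lemma opGa_cycleVec_one_one (hk : 1 ≤ k) : opGa F k t (cv 1 1) = lv (t - 1) := by
  apply map_cycleVec_eq _ (by omega) <;> intros <;> simp_all [opGa] <;> omega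

lemma opEt_cycleVec_two {n : ℕ} (hn : 2 ≤ n) : opEt F k t (cv 2 n) = 0 := by
  apply map_cycleVec_eq _ (by omega) <;> intros <;>
    simp_all [opEt, loopVec_eq_zero] <;> omega

lemma opEt_loopVec (j : ℕ) : opEt F k t (lv j) = lv (j + 1) := by
  rw [loopVec]; split_ifs with h <;> simp [opEt]
  rw [loopVec_eq_zero (by omega)]

lemma opE1_cycleVec {s : ℕ} (n : ℕ) (hs : s < 3) :
    opE1 F (cv s n) = if s = 2 then 0 else cv s n := by
  interval_cases s <;> simp only [cycleVec] <;> split_ifs <;> simp_all [opE1]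

lemma opE2_cycleVec {s : ℕ} (n : ℕ) (hs : s < 3) :
    opE2 F (cv s n) = if s = 2 then cv s n else 0 := by
  interval_cases s <;> simp only [cycleVec] <;> split_ifs <;> simp_all [opE2]

lemma opE1_loopVec (j : ℕ) : opE1 F (lv j) = 0 := by
  rw [loopVec]; split_ifs <;> simp [opE1]

lemma opE2_loopVec (j : ℕ) : opE2 F (lv j) = lv j := by
  rw [loopVec]; split_ifs <;> simp [opE2]

end Model

section Representation

open PathIndex

variable {F k t c}

local notation "cv" => cycleVec F k t
local notation "lv" => loopVec F t
local notation "e₁" => opE1 F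
local notation "e₂" => opE2 F
local notation "α" => opAl F k t c
local notation "β" => opBe F k t
local notation "γ" => opGa F k t
local notation "η" => opEt F k t

lemma opEt_cycleVec_two_one (hk : 1 ≤ k) : η (cv 2 1) = cv 2 (3 * k - 1) := by
  simp [cycleVec, opEt, show 1 < 3 * k by omega]

lemma opAl_single_one {n : ℕ} (hn : 1 ≤ n) : α (single (cyc 1 n) 1) = cv 0 (n + 1) := by
  simp [opAl, hn]

lemma opAl_single_zero : α (single (cyc 0 0) 1) = cv 0 1 := by
  simp [opAl]

lemma opAl_single_zero_one : α (single (cyc 0 1) 1) = c • cv 0 (3 * k) := by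
  simp [opAl]

lemma opAl_single_of_not {s n : ℕ} (h : ¬ (s = 1 ∧ 1 ≤ n)) (h' : ¬ (s = 0 ∧ n ≤ 1)) :
    α (single (cyc s n) 1) = 0 := by
  simp only [opAl, linearCombination_single, one_smul]
  rw [if_neg (by omega), if_neg (by omega)]

lemma opBe_single_two {n : ℕ} (hn : 1 ≤ n) : β (single (cyc 2 n) 1) = cv 1 (n + 1) := by
  simp [opBe, hn]

lemma opBe_single_of_not {s n : ℕ} (h : ¬ (s = 2 ∧ 1 ≤ n)) : β (single (cyc s n) 1) = 0 := by
  simp only [opBe, linearCombination_single, one_smul]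
  rw [if_neg h]

lemma opBe_single_loop_zero : β (single (loop 0) 1) = cv 1 1 := by simp [opBe]

lemma opBe_single_loop_one : β (single (loop 1) 1) = cv 0 (3 * k - 1) := by simp [opBe]

lemma opBe_single_loop {j : ℕ} (hj : 2 ≤ j) : β (single (loop j) 1) = 0 := by
  simp [opBe, show j ≠ 0 by omega, show j ≠ 1 by omega]

lemma opGa_single_zero (n : ℕ) : γ (single (cyc 0 n) 1) = cv 2 (n + 1) := by simp [opGa]

lemma opGa_single_one_one : γ (single (cyc 1 1) 1) = lv (t - 1) := by simp [opGa]

lemma opGa_single_of_not {s n : ℕ} (h : s ≠ 0) (h' : ¬ (s = 1 ∧ n = 1)) :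
    γ (single (cyc s n) 1) = 0 := by
  simp only [opGa, linearCombination_single, one_smul]
  rw [if_neg h, if_neg h']

lemma opEt_single_two_one : η (single (cyc 2 1) 1) = cv 2 (3 * k - 1) := by simp [opEt]

lemma opEt_single_of_not {s n : ℕ} (h : ¬ (s = 2 ∧ n = 1)) : η (single (cyc s n) 1) = 0 := by
  simp only [opEt, linearCombination_single, one_smul]
  rw [if_neg h]

lemma opEt_single_loop (j : ℕ) : η (single (loop j) 1) = lv (j + 1) := by simp [opEt]

lemma opAl_single_loop (j : ℕ) : α (single (loop j) 1) = 0 := by simp [opAl]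

lemma opGa_single_loop (j : ℕ) : γ (single (loop j) 1) = 0 := by simp [opGa]

lemma opAl_opBe_opGa_pow_cycleVec (hk : 1 ≤ k) (ht : 3 ≤ t) (m n : ℕ) :
    ((α * β * γ) ^ m) (cv 0 n) = cv 0 (n + 3 * m) := by
  induction m with
  | zero => simp
  | succ m ih =>
    rw [pow_succ', Module.End.mul_apply, ih, Module.End.mul_apply, Module.End.mul_apply,
      opGa_cycleVec_zero hk, opBe_cycleVec_two ht, opAl_cycleVec_one hk]
    rfl

lemma opGa_opAl_opBe_pow_cycleVec (hk : 1 ≤ k) (ht : 3 ≤ t) (m n : ℕ) :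
    ((γ * α * β) ^ m) (cv 2 n) = cv 2 (n + 3 * m) := by
  induction m with
  | zero => simp
  | succ m ih =>
    rw [pow_succ', Module.End.mul_apply, ih, Module.End.mul_apply, Module.End.mul_apply,
      opBe_cycleVec_two ht, opAl_cycleVec_one hk, opGa_cycleVec_zero hk]
    rfl

lemma opEt_pow_loopVec (m j : ℕ) : (η ^ m) (lv j) = lv (j + m) := by
  induction m with
  | zero => simp
  | succ m ih => rw [pow_succ', Module.End.mul_apply, ih, opEt_loopVec]; rfl

/-- Two endomorphisms of the model space agree if they agree on basis vectors. -/
lemma model_ext {f g : Module.End F (PathIndex →₀ F)}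
    (h : ∀ s n, f (single (cyc s n) 1) = g (single (cyc s n) 1))
    (h' : ∀ j, f (single (loop j) 1) = g (single (loop j) 1)) : f = g := by
  refine Finsupp.lhom_ext' fun i ↦ LinearMap.ext_ring ?_
  rcases i with ⟨s, n⟩ | j
  · exact h s n
  · exact h' j

lemma opE1_single (s n : ℕ) :
    e₁ (single (cyc s n) 1) = if s = 2 then 0 else single (cyc s n) 1 := by simp [opE1]

lemma opE1_single_loop (j : ℕ) : e₁ (single (loop j) 1) = 0 := by simp [opE1]

lemma opE2_single (s n : ℕ) :
    e₂ (single (cyc s n) 1) = if s = 2 then single (cyc s n) 1 else 0 := by simp [opE2]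

lemma opE2_single_loop (j : ℕ) : e₂ (single (loop j) 1) = single (loop j) 1 := by simp [opE2]

lemma opE1_mul_opAl : e₁ * α = α := by
  refine model_ext (fun s n ↦ ?_) fun j ↦ ?_
  · simp only [Module.End.mul_apply, opAl, linearCombination_single, one_smul]
    split_ifs <;> simp [opE1_cycleVec]
  · simp [opAl_single_loop]

lemma opAl_mul_opE1 : α * e₁ = α := by
  refine model_ext (fun s n ↦ ?_) fun j ↦ ?_
  · rw [Module.End.mul_apply, opE1_single]
    split_ifs with h
    · rw [map_zero, opAl_single_of_not (by omega) (by omega)]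
    · rfl
  · simp [opE1_single_loop, opAl_single_loop]

lemma opE1_mul_opBe : e₁ * β = β := by
  refine model_ext (fun s n ↦ ?_) fun j ↦ ?_
  · simp only [Module.End.mul_apply, opBe, linearCombination_single, one_smul]
    split_ifs <;> simp [opE1_cycleVec]
  · simp only [Module.End.mul_apply, opBe, linearCombination_single, one_smul]
    split_ifs <;> simp [opE1_cycleVec]

lemma opBe_mul_opE2 : β * e₂ = β := by
  refine model_ext (fun s n ↦ ?_) fun j ↦ ?_
  · rw [Module.End.mul_apply, opE2_single]
    split_ifs with h
    · rfl
    · rw [map_zero, opBe_single_of_not (by omega)]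
  · rw [Module.End.mul_apply, opE2_single_loop]

lemma opE2_mul_opGa : e₂ * γ = γ := by
  refine model_ext (fun s n ↦ ?_) fun j ↦ ?_
  · simp only [Module.End.mul_apply, opGa, linearCombination_single, one_smul]
    split_ifs <;> simp [opE2_cycleVec, opE2_loopVec]
  · simp [opGa_single_loop]

lemma opGa_mul_opE1 : γ * e₁ = γ := by
  refine model_ext (fun s n ↦ ?_) fun j ↦ ?_
  · rw [Module.End.mul_apply, opE1_single]
    split_ifs with h
    · rw [map_zero, opGa_single_of_not (by omega) (by omega)]
    · rfl
  · simp [opE1_single_loop, opGa_single_loop]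

lemma opE2_mul_opEt : e₂ * η = η := by
  refine model_ext (fun s n ↦ ?_) fun j ↦ ?_
  · simp only [Module.End.mul_apply, opEt, linearCombination_single, one_smul]
    split_ifs <;> simp [opE2_cycleVec]
  · rw [Module.End.mul_apply, opEt_single_loop, opE2_loopVec]

lemma opEt_mul_opE2 : η * e₂ = η := by
  refine model_ext (fun s n ↦ ?_) fun j ↦ ?_
  · rw [Module.End.mul_apply, opE2_single]
    split_ifs with h
    · rfl
    · rw [map_zero, opEt_single_of_not (by omega)]
  · rw [Module.End.mul_apply, opE2_single_loop]

lemma opBe_mul_opEt (hk : 1 ≤ k) (ht : 3 ≤ t) : β * η = (α * β * γ) ^ (k - 1) * (α * β) := by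
  refine model_ext (fun s n ↦ ?_) fun j ↦ ?_
  · simp only [Module.End.mul_apply]
    by_cases h : s = 2 ∧ 1 ≤ n
    · obtain ⟨rfl, hn⟩ := h
      rw [opBe_single_two hn, opAl_cycleVec_one hk, opAl_opBe_opGa_pow_cycleVec hk ht]
      by_cases h1 : n = 1
      · subst h1
        rw [opEt_single_two_one, opBe_cycleVec_two ht, Nat.sub_add_cancel (by omega),
          cycleVec_socle_one hk]
        congr 1; omega
      · rw [opEt_single_of_not (by omega), map_zero, cycleVec_eq_zero (by omega)]
    · rw [opEt_single_of_not (by omega), opBe_single_of_not h]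
      simp only [map_zero]
  · simp only [Module.End.mul_apply]
    rw [opEt_single_loop]
    obtain rfl | rfl | hj : j = 0 ∨ j = 1 ∨ 2 ≤ j := by omega
    · rw [opBe_single_loop_zero, opBe_loopVec_one ht, opAl_cycleVec_one hk,
        opAl_opBe_opGa_pow_cycleVec hk ht]
      congr 1; omega
    · rw [opBe_single_loop_one, opBe_loopVec (by omega), opAl_cycleVec_zero hk (by omega), map_zero]
    · rw [opBe_single_loop hj, opBe_loopVec (by omega)]
      simp only [map_zero]

lemma opGa_mul_opBe (hk : 1 ≤ k) (ht : 3 ≤ t) : γ * β = η ^ (t - 1) := by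
  obtain ⟨m, rfl⟩ : ∃ m, t = m + 3 := ⟨t - 3, by omega⟩
  refine model_ext (fun s n ↦ ?_) fun j ↦ ?_
  · rw [show m + 3 - 1 = m + 1 + 1 by omega]
    simp only [Module.End.mul_apply, pow_succ]
    by_cases h : s = 2 ∧ 1 ≤ n
    · obtain ⟨rfl, hn⟩ := h
      rw [opBe_single_two hn, opGa_cycleVec_one hk (by omega)]
      by_cases h1 : n = 1
      · rw [h1, opEt_single_two_one, opEt_cycleVec_two (by omega), map_zero]
      · rw [opEt_single_of_not (by omega), map_zero, map_zero]
    · rw [opEt_single_of_not (by omega), opBe_single_of_not h]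
      simp only [map_zero]
  · rw [show m + 3 - 1 = m + 1 + 1 by omega, pow_succ, Module.End.mul_apply, Module.End.mul_apply,
      opEt_single_loop, opEt_pow_loopVec]
    obtain rfl | rfl | hj : j = 0 ∨ j = 1 ∨ 2 ≤ j := by omega
    · rw [opBe_single_loop_zero, opGa_cycleVec_one_one hk]
      congr 1; omega
    · rw [opBe_single_loop_one, opGa_cycleVec_zero hk, Nat.sub_add_cancel (by omega),
        cycleVec_socle_two hk]
      congr 1; omega
    · rw [opBe_single_loop hj, map_zero, loopVec_eq_zero (by omega)]

lemma opEt_mul_opGa (hk : 1 ≤ k) (ht : 3 ≤ t) : η * γ = (γ * α * β) ^ (k - 1) * (γ * α) := by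
  refine model_ext (fun s n ↦ ?_) fun j ↦ ?_
  · simp only [Module.End.mul_apply]
    by_cases h : s = 0
    · subst h
      rw [opGa_single_zero]
      obtain rfl | rfl | hn : n = 0 ∨ n = 1 ∨ 2 ≤ n := by omega
      · rw [opAl_single_zero, opGa_cycleVec_zero hk, opGa_opAl_opBe_pow_cycleVec hk ht,
          opEt_cycleVec_two_one hk]
        congr 1; omega
      · rw [opAl_single_zero_one, map_smul, opGa_cycleVec_zero hk, opEt_cycleVec_two (by omega),
          cycleVec_eq_zero (n := 3 * k + 1) (by omega), smul_zero, map_zero]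
      · rw [opAl_single_of_not (by omega) (by omega), opEt_cycleVec_two (by omega)]
        simp only [map_zero]
    · by_cases h1 : s = 1 ∧ 1 ≤ n
      · obtain ⟨rfl, hn⟩ := h1
        rw [opAl_single_one hn, opGa_cycleVec_zero hk, opGa_opAl_opBe_pow_cycleVec hk ht]
        by_cases h1 : n = 1
        · rw [h1, opGa_single_one_one, opEt_loopVec, Nat.sub_add_cancel (by omega),
            ← cycleVec_socle_two hk]
          congr 1; omega
        · rw [opGa_single_of_not (by omega) (by omega), map_zero, cycleVec_eq_zero (by omega)]
      · rw [opGa_single_of_not h (by omega), opAl_single_of_not (by omega) (by omega)]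
        simp only [map_zero]
  · simp [opGa_single_loop, opAl_single_loop]

lemma opBe_mul_opEt_mul_opEt (hk : 1 ≤ k) : β * η * η = 0 := by
  refine model_ext (fun s n ↦ ?_) fun j ↦ ?_
  · simp only [Module.End.mul_apply]
    by_cases h : s = 2 ∧ n = 1
    · obtain ⟨rfl, rfl⟩ := h
      rw [opEt_single_two_one, opEt_cycleVec_two (by omega), map_zero]; rfl
    · rw [opEt_single_of_not h]; simp
  · simp only [Module.End.mul_apply]
    rw [opEt_single_loop, opEt_loopVec, opBe_loopVec (by omega)]; rfl

lemma opEt_mul_opEt_mul_opGa (hk : 1 ≤ k) (ht : 3 ≤ t) : η * η * γ = 0 := by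
  refine model_ext (fun s n ↦ ?_) fun j ↦ ?_
  · simp only [Module.End.mul_apply, opGa, linearCombination_single, one_smul, LinearMap.zero_apply]
    split_ifs
    · obtain rfl | hn : n = 0 ∨ 1 ≤ n := by omega
      · rw [opEt_cycleVec_two_one hk, opEt_cycleVec_two (by omega)]
      · rw [opEt_cycleVec_two (by omega), map_zero]
    · rw [opEt_loopVec, opEt_loopVec, loopVec_eq_zero (by omega)]
    · simp
  · simp [opGa_single_loop]

lemma opAl_mul_opAl (hk : 1 ≤ k) (ht : 3 ≤ t) : α * α = c • (α * β * γ) ^ k := by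
  obtain ⟨m, rfl⟩ : ∃ m, k = m + 1 := ⟨k - 1, by omega⟩
  refine model_ext (fun s n ↦ ?_) fun j ↦ ?_
  · rw [pow_succ]
    simp only [Module.End.mul_apply, LinearMap.smul_apply]
    by_cases h : s = 0
    · subst h
      rw [opGa_single_zero, opBe_cycleVec_two ht, opAl_cycleVec_one hk,
        opAl_opBe_opGa_pow_cycleVec hk ht]
      obtain rfl | rfl | hn : n = 0 ∨ n = 1 ∨ 2 ≤ n := by omega
      · rw [opAl_single_zero, opAl_cycleVec_zero_one hk]
        congr 2; omega
      · rw [opAl_single_zero_one, map_smul, opAl_cycleVec_zero hk (by omega),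
          cycleVec_eq_zero (by omega)]
      · rw [opAl_single_of_not (by omega) (by omega), map_zero, cycleVec_eq_zero (by omega),
          smul_zero]
    · by_cases h1 : s = 1 ∧ 1 ≤ n
      · obtain ⟨rfl, hn⟩ := h1
        rw [opAl_single_one hn, opAl_cycleVec_zero hk (by omega)]
        by_cases h1 : n = 1
        · rw [h1, opGa_single_one_one, opBe_loopVec (by omega)]
          simp only [map_zero, smul_zero]
        · rw [opGa_single_of_not (by omega) (by omega)]
          simp only [map_zero, smul_zero]
      · rw [opGa_single_of_not h (by omega), opAl_single_of_not (by omega) (by omega)]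
        simp only [map_zero, smul_zero]
  · simp [pow_succ, opGa_single_loop, opAl_single_loop]

lemma opE1_add_opE2 : e₁ + e₂ = 1 := by
  refine model_ext (fun s n ↦ ?_) fun j ↦ ?_
  · rw [LinearMap.add_apply, opE1_single, opE2_single]
    split_ifs <;> simp
  · simp [opE1_single_loop, opE2_single_loop]

lemma opE1_mul_opE1 : e₁ * e₁ = e₁ := by
  refine model_ext (fun s n ↦ ?_) fun j ↦ ?_
  · rw [Module.End.mul_apply, opE1_single]
    split_ifs with h <;> simp [opE1_single, h]
  · simp [opE1_single_loop]

lemma opE1_mul_opE2 : e₁ * e₂ = 0 := by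
  refine model_ext (fun s n ↦ ?_) fun j ↦ ?_
  · rw [Module.End.mul_apply, opE2_single]
    split_ifs with h <;> simp [opE1_single, h]
  · simp [opE1_single_loop, opE2_single_loop]

lemma opE2_mul_opE1 : e₂ * e₁ = 0 := by
  refine model_ext (fun s n ↦ ?_) fun j ↦ ?_
  · rw [Module.End.mul_apply, opE1_single]
    split_ifs with h <;> simp [opE2_single, h]
  · simp [opE1_single_loop]

lemma opE2_mul_opE2 : e₂ * e₂ = e₂ := by
  refine model_ext (fun s n ↦ ?_) fun j ↦ ?_
  · rw [Module.End.mul_apply, opE2_single]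
    split_ifs with h <;> simp [opE2_single, h]
  · simp [opE2_single_loop]

end Representation

/-- The operator on the model space attached to a generator. -/
def genOp : Gen → Module.End F (PathIndex →₀ F)
  | .e1 => opE1 F
  | .e2 => opE2 F
  | .a => opAl F k t c
  | .b => opBe F k t
  | .g => opGa F k t
  | .h => opEt F k t

/-- The operators on the model space satisfy the defining relations. -/
lemma lift_genOp_eq_of_rel {F : Type} [Field F] {k t : ℕ} {c : F} (hk : 1 ≤ k) (ht : 3 ≤ t)
    {x y : FreeAlgebra F Gen} (h : Rel F k t c x y) :
    FreeAlgebra.lift F (genOp F k t c) x = FreeAlgebra.lift F (genOp F k t c) y := by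
  cases h <;> simp only [gen, map_add, map_mul, map_pow, map_one, map_zero, map_smul,
    FreeAlgebra.lift_ι_apply, genOp]
  · exact opE1_add_opE2
  · exact opE1_mul_opE1
  · exact opE2_mul_opE2
  · exact opE1_mul_opE2
  · exact opE2_mul_opE1
  · exact opE1_mul_opAl
  · exact opAl_mul_opE1
  · exact opE1_mul_opBe
  · exact opBe_mul_opE2
  · exact opE2_mul_opGa
  · exact opGa_mul_opE1
  · exact opE2_mul_opEt
  · exact opEt_mul_opE2
  · exact opBe_mul_opEt hk ht
  · exact opGa_mul_opBe hk ht
  · exact opEt_mul_opGa hk ht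
  · exact opBe_mul_opEt_mul_opEt hk
  · exact opEt_mul_opEt_mul_opGa hk ht
  · exact opAl_mul_opAl hk ht

/-- The representation of the algebra on the model space. -/
def modelRep {F : Type} [Field F] {k t : ℕ} {c : F} (hk : 1 ≤ k) (ht : 3 ≤ t) :
    BA F k t c →ₐ[F] Module.End F (PathIndex →₀ F) :=
  RingQuot.liftAlgHom F ⟨FreeAlgebra.lift F (genOp F k t c), fun _ _ ↦ lift_genOp_eq_of_rel hk ht⟩

lemma modelRep_mk {F : Type} [Field F] {k t : ℕ} {c : F} (hk : 1 ≤ k) (ht : 3 ≤ t) (g : Gen) :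
    modelRep hk ht (mk F k t c (gen F g)) = genOp F k t c g :=
  (RingQuot.liftAlgHom_mkAlgHom_apply _ _ _ _).trans (FreeAlgebra.lift_ι_apply _ _)

section Coordinates

open PathIndex

variable {F k t c}

local notation "cv" => cycleVec F k t
local notation "lv" => loopVec F t
local notation "P" => cyclePath F k t c
local notation "ar" => arrow F k t c

/-- The coordinates of an element with respect to paths. -/
def coord (hk : 1 ≤ k) (ht : 3 ≤ t) : BA F k t c →ₗ[F] (PathIndex →₀ F) :=
  LinearMap.applyₗ (cv 0 0 + lv 0) ∘ₗ (modelRep hk ht).toLinearMap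

lemma coord_mul (hk : 1 ≤ k) (ht : 3 ≤ t) (x y : BA F k t c) :
    coord hk ht (x * y) = modelRep hk ht x (coord hk ht y) := by
  simp [coord]

lemma modelRep_arrow_cycleVec (hk : 1 ≤ k) (ht : 3 ≤ t) (s n : ℕ) :
    modelRep hk ht (ar s) (cv (s + 1) n) = cv s (n + 1) := by
  obtain h | h | h : s % 3 = 0 ∨ s % 3 = 1 ∨ s % 3 = 2 := by omega
  · rw [arrow_congr (r := 0) h, arrow_zero, Al, modelRep_mk, cycleVec_congr (r := 1) n (by omega),
      cycleVec_congr (r := 0) (n + 1) (by omega)]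
    exact opAl_cycleVec_one hk n
  · rw [arrow_congr (r := 1) h, arrow_one, Be, modelRep_mk, cycleVec_congr (r := 2) n (by omega),
      cycleVec_congr (r := 1) (n + 1) (by omega)]
    exact opBe_cycleVec_two ht n
  · rw [arrow_congr (r := 2) h, arrow_two, Ga, modelRep_mk, cycleVec_congr (r := 0) n (by omega),
      cycleVec_congr (r := 2) (n + 1) (by omega)]
    exact opGa_cycleVec_zero hk n

lemma coord_cyclePath (hk : 1 ≤ k) (ht : 3 ≤ t) (n s : ℕ) : coord hk ht (P n s) = cv s n := by
  induction n generalizing s with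
  | zero =>
    simp only [coord, cyclePath, triv, LinearMap.comp_apply, LinearMap.applyₗ_apply_apply,
      AlgHom.toLinearMap_apply]
    split_ifs with h
    · rw [E2, modelRep_mk, cycleVec_congr (r := 2) 0 h]
      simp only [genOp, map_add, opE2_cycleVec 0 (show 0 < 3 by omega), opE2_loopVec]
      simp [loopVec, cycleVec]
    · rw [E1, modelRep_mk]
      simp only [genOp, map_add, opE1_cycleVec 0 (show 0 < 3 by omega), opE1_loopVec]
      simp [cycleVec, h]
  | succ n ih => rw [cyclePath, coord_mul, ih, modelRep_arrow_cycleVec]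

lemma coord_loopPath (hk : 1 ≤ k) (ht : 3 ≤ t) (j : ℕ) :
    coord hk ht (loopPath F k t c j) = lv j := by
  induction j with
  | zero =>
    have h := coord_cyclePath (c := c) hk ht 0 2
    simpa [cyclePath, triv, loopPath, cycleVec, loopVec] using h
  | succ j ih =>
    rw [← Et_mul_loopPath, coord_mul, ih, Et, modelRep_mk]
    exact opEt_loopVec j

end Coordinates

open PathIndex

/-- Indices of the path basis. -/
def goodIndex : Set PathIndex := {i | match i with
  | cyc s n => s < 3 ∧ (1 ≤ n ∧ n < 3 * k ∨ s = 0 ∧ (n = 0 ∨ n = 3 * k))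
  | loop j => j ≤ t}

/-- A basis of the algebra adapted to commutators. -/
def adapted : PathIndex → BA F k t c
  | cyc s n =>
    if s = 0 then (if n = 3 * k then cyclePath F k t c n 0 + cyclePath F k t c n 2
      else cyclePath F k t c n 0)
    else if n % 3 = 0 then cyclePath F k t c n 0 + cyclePath F k t c n s
    else if s = 1 ∧ n = 2 then cyclePath F k t c n 1 + loopPath F k t c (t - 1)
    else cyclePath F k t c n s
  | loop j => loopPath F k t c j

/-- The change of coordinates from paths to the adapted basis in characteristic two. -/
def changeCoord : (PathIndex →₀ F) →ₗ[F] (PathIndex →₀ F) :=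
  linearCombination F fun
    | cyc s n => single (cyc s n) 1 +
      (if s = 0 then (if n = 3 * k then single (loop t) 1 else 0)
      else if n % 3 = 0 then single (cyc 0 n) 1
      else if s = 1 ∧ n = 2 then single (loop (t - 1)) 1 else 0)
    | loop j => single (loop j) 1

section Adapted

variable {F k t c}

local notation "cv" => cycleVec F k t
local notation "lv" => loopVec F t
local notation "P" => cyclePath F k t c
local notation "ar" => arrow F k t c
local notation "σ" => adapted F k t c

lemma model_add_self [CharP F 2] (v : PathIndex →₀ F) : v + v = 0 := by
  rw [← two_smul F v, CharTwo.two_eq_zero, zero_smul]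

lemma changeCoord_adapted [CharP F 2] (hk : 1 ≤ k) (ht : 3 ≤ t) {i : PathIndex}
    (hi : i ∈ goodIndex k t) : changeCoord F k t (coord hk ht (σ i)) = single i 1 := by
  rcases i with ⟨s, n⟩ | j
  · obtain ⟨hs, h | ⟨rfl, rfl | rfl⟩⟩ := hi
    · have h0 : ∀ r < 3, cv r n = single (cyc r n) 1 := fun r hr ↦ by
        rw [cycleVec, if_neg (by omega), if_pos h.2, Nat.mod_eq_of_lt hr]
      have hl : lv (t - 1) = single (loop (t - 1)) 1 := by rw [loopVec, if_pos (by omega)]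
      have hn : n ≠ 3 * k := by omega
      rw [adapted]
      split_ifs with h1 h2 h2 <;>
        simp only [map_add, coord_cyclePath, coord_loopPath, h0 s hs, h0 0 (by omega),
          h0 1 (by omega), hl, changeCoord, linearCombination_single, one_smul]
      · simp [h1, hn]
      · simp only [h1, h2, hn, if_true, if_false, add_zero]
        rw [add_comm, add_assoc, model_add_self, add_zero]
      · simp only [h2.1, h2.2, true_and, if_true, if_false]
        norm_num
        rw [add_assoc, model_add_self, add_zero]
      · simp [h1, h2, *]
    · rw [adapted, if_pos rfl, if_neg (by omega), coord_cyclePath]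
      simp [cycleVec, changeCoord]; omega
    · rw [adapted, if_pos rfl, if_pos rfl, map_add, coord_cyclePath, coord_cyclePath,
        cycleVec_socle_two hk]
      have h1 : k ≠ 0 := by omega
      simp [cycleVec, changeCoord, loopVec, h1, add_assoc, model_add_self]
  · simp only [goodIndex, Set.mem_ofPred_eq] at hi
    simp [adapted, coord_loopPath, loopVec, hi, changeCoord]

lemma linearIndepOn_adapted [CharP F 2] (hk : 1 ≤ k) (ht : 3 ≤ t) :
    LinearIndepOn F σ (goodIndex k t) := by
  refine LinearIndependent.of_comp (changeCoord F k t ∘ₗ coord hk ht) ?_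
  have h : ((changeCoord F k t ∘ₗ coord hk ht) ∘ fun i : goodIndex k t ↦ σ i) =
      fun i : goodIndex k t ↦ single (i : PathIndex) (1 : F) := by
    ext1 i
    exact changeCoord_adapted hk ht i.2
  rw [h]
  exact (linearIndependent_single_one F PathIndex).comp _ Subtype.val_injective

end Adapted

open PathIndex

/-- Indices of the adapted basis vectors whose squares lie in the commutator subspace. -/
def squareIndex : Set PathIndex := {i | i ∈ goodIndex k t ∧ match i with
  | cyc s n => s = 0 → (n % 3 = 0 → 3 * k < 2 * n) ∧ (n = 1 → c = 0)
  | loop j => t < 2 * j}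

section BasisSet

variable {F k t c}

local notation "P" => cyclePath F k t c
local notation "σ" => adapted F k t c
local notation "α" => Al F k t c
local notation "β" => Be F k t c
local notation "γ" => Ga F k t c
local notation "η" => Et F k t c

lemma adapted_of_mod_three_ne {s n : ℕ} (hn : n % 3 ≠ 0) (h : ¬ (s = 1 ∧ n = 2)) :
    σ (cyc s n) = P n s := by
  rw [adapted]
  split_ifs <;> first | omega | simp_all

lemma adapted_of_three_dvd {s n : ℕ} (hs : s ≠ 0) (hn : n % 3 = 0) :
    σ (cyc s n) = P n 0 + P n s := by
  rw [adapted, if_neg hs, if_pos hn]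

lemma adapted_zero {n : ℕ} (hn : n ≠ 3 * k) : σ (cyc 0 n) = P n 0 := by
  rw [adapted, if_pos rfl, if_neg hn]

lemma adapted_socle : σ (cyc 0 (3 * k)) = P (3 * k) 0 + P (3 * k) 2 := by
  rw [adapted, if_pos rfl, if_pos rfl]

lemma adapted_one_two : σ (cyc 1 2) = P 2 1 + loopPath F k t c (t - 1) := by
  simp [adapted]

lemma ABG_pow {i : ℕ} (hi : 1 ≤ i) : ABG F k t c ^ i = P (3 * i) 0 := by
  rw [ABG_eq, cyclePath_three_pow _ _ hi]

lemma BGA_pow {i : ℕ} (hi : 1 ≤ i) : BGA F k t c ^ i = P (3 * i) 1 := by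
  rw [BGA_eq, cyclePath_three_pow _ _ hi]

lemma GAB_pow {i : ℕ} (hi : 1 ≤ i) : GAB F k t c ^ i = P (3 * i) 2 := by
  rw [GAB_eq, cyclePath_three_pow _ _ hi]

lemma ABG_pow_mul_Al (i : ℕ) : ABG F k t c ^ i * α = P (3 * i + 1) 0 := by
  rw [ABG_eq, ← cyclePath_three_pow_mul, cyclePath_one, arrow_zero]

lemma BGA_pow_mul_Be (i : ℕ) : BGA F k t c ^ i * β = P (3 * i + 1) 1 := by
  rw [BGA_eq, ← cyclePath_three_pow_mul, cyclePath_one, arrow_one]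

lemma GAB_pow_mul_Ga (i : ℕ) : GAB F k t c ^ i * γ = P (3 * i + 1) 2 := by
  rw [GAB_eq, ← cyclePath_three_pow_mul, cyclePath_one, arrow_two]

lemma ABG_pow_mul_Al_mul_Be (i : ℕ) : ABG F k t c ^ i * (α * β) = P (3 * i + 2) 0 := by
  rw [ABG_eq, ← cyclePath_three_pow_mul, ← arrow_mul_arrow]; rfl

lemma BGA_pow_mul_Be_mul_Ga (i : ℕ) : BGA F k t c ^ i * (β * γ) = P (3 * i + 2) 1 := by
  rw [BGA_eq, ← cyclePath_three_pow_mul, ← arrow_mul_arrow]; rfl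

lemma GAB_pow_mul_Ga_mul_Al (i : ℕ) : GAB F k t c ^ i * (γ * α) = P (3 * i + 2) 2 := by
  rw [GAB_eq, ← cyclePath_three_pow_mul, ← arrow_mul_arrow]; rfl

lemma Be_mul_Ga_add_Ga_mul_Be (ht : 3 ≤ t) : β * γ + γ * β = σ (cyc 1 2) := by
  rw [adapted_one_two, Ga_mul_Be, loopPath_of_pos (by omega), ← arrow_mul_arrow]; rfl

lemma mem_goodIndex_cyc {s n : ℕ} : cyc s n ∈ goodIndex k t ↔
    s < 3 ∧ (1 ≤ n ∧ n < 3 * k ∨ s = 0 ∧ (n = 0 ∨ n = 3 * k)) := Iff.rfl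

lemma mem_goodIndex_loop {j : ℕ} : loop j ∈ goodIndex k t ↔ j ≤ t := Iff.rfl

lemma mem_squareIndex_cyc {s n : ℕ} : cyc s n ∈ squareIndex F k t c ↔
    cyc s n ∈ goodIndex k t ∧ (s = 0 → (n % 3 = 0 → 3 * k < 2 * n) ∧ (n = 1 → c = 0)) := Iff.rfl

lemma mem_squareIndex_loop {j : ℕ} : loop j ∈ squareIndex F k t c ↔ j ≤ t ∧ t < 2 * j := Iff.rfl

lemma cyc_mem_squareIndex {s n : ℕ} (hs : s < 3) (h1 : 1 ≤ n) (h2 : n < 3 * k)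
    (h : s ≠ 0 ∨ (n % 3 = 0 → 3 * k < 2 * n) ∧ n ≠ 1) : cyc s n ∈ squareIndex F k t c :=
  mem_squareIndex_cyc.2 ⟨mem_goodIndex_cyc.2 ⟨hs, .inl ⟨h1, h2⟩⟩, fun h0 ↦
    h.elim (fun h ↦ absurd h0 h) fun h ↦ ⟨h.1, fun h' ↦ absurd h' h.2⟩⟩

lemma B12_subset (hk : 1 ≤ k) : B12 F k t c ⊆ σ '' squareIndex F k t c := by
  rintro x (((rfl | rfl) | ⟨i, ⟨hi, hi'⟩, rfl⟩) | ⟨i, ⟨hi, hi'⟩, rfl⟩)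
  · refine ⟨cyc 1 1, cyc_mem_squareIndex (by omega) (by omega) (by omega) (by omega), ?_⟩
    rw [adapted_of_mod_three_ne (by omega) (by omega), cyclePath_one, arrow_one]
  · refine ⟨cyc 0 2, cyc_mem_squareIndex (by omega) (by omega) (by omega) (by omega), ?_⟩
    rw [adapted_of_mod_three_ne (by omega) (by omega), ← arrow_mul_arrow]; rfl
  · refine ⟨cyc 1 (3 * i + 1), cyc_mem_squareIndex (by omega) (by omega) (by omega) (by omega), ?_⟩
    rw [adapted_of_mod_three_ne (by omega) (by omega)]
    exact (BGA_pow_mul_Be i).symm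
  · refine ⟨cyc 0 (3 * i + 2), cyc_mem_squareIndex (by omega) (by omega) (by omega) (by omega), ?_⟩
    rw [adapted_of_mod_three_ne (by omega) (by omega)]
    exact (ABG_pow_mul_Al_mul_Be i).symm

lemma B21_subset (hk : 1 ≤ k) : B21 F k t c ⊆ σ '' squareIndex F k t c := by
  rintro x (((rfl | rfl) | ⟨i, ⟨hi, hi'⟩, rfl⟩) | ⟨i, ⟨hi, hi'⟩, rfl⟩)
  · refine ⟨cyc 2 1, cyc_mem_squareIndex (by omega) (by omega) (by omega) (by omega), ?_⟩
    rw [adapted_of_mod_three_ne (by omega) (by omega), cyclePath_one, arrow_two]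
  · refine ⟨cyc 2 2, cyc_mem_squareIndex (by omega) (by omega) (by omega) (by omega), ?_⟩
    rw [adapted_of_mod_three_ne (by omega) (by omega), ← arrow_mul_arrow]; rfl
  · refine ⟨cyc 2 (3 * i + 1), cyc_mem_squareIndex (by omega) (by omega) (by omega) (by omega), ?_⟩
    rw [adapted_of_mod_three_ne (by omega) (by omega)]
    exact (GAB_pow_mul_Ga i).symm
  · refine ⟨cyc 2 (3 * i + 2), cyc_mem_squareIndex (by omega) (by omega) (by omega) (by omega), ?_⟩
    rw [adapted_of_mod_three_ne (by omega) (by omega)]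
    exact (GAB_pow_mul_Ga_mul_Al i).symm

lemma K11_subset (hk : 1 ≤ k) (ht : 3 ≤ t) : K11 F k t c ⊆ σ '' squareIndex F k t c := by
  rintro x (((rfl | ⟨i, ⟨hi, hi'⟩, rfl⟩) | ⟨i, ⟨hi, hi'⟩, rfl⟩) | ⟨i, ⟨hi, hi'⟩, rfl⟩)
  · exact ⟨cyc 1 2, cyc_mem_squareIndex (by omega) (by omega) (by omega) (by omega),
      (Be_mul_Ga_add_Ga_mul_Be ht).symm⟩
  · refine ⟨cyc 1 (3 * i), cyc_mem_squareIndex (by omega) (by omega) (by omega) (by omega), ?_⟩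
    rw [adapted_of_three_dvd (by omega) (by omega), ← ABG_pow hi, ← BGA_pow hi]
  · refine ⟨cyc 0 (3 * i + 1), cyc_mem_squareIndex (by omega) (by omega) (by omega) (by omega), ?_⟩
    rw [adapted_of_mod_three_ne (by omega) (by omega)]
    exact (ABG_pow_mul_Al i).symm
  · refine ⟨cyc 1 (3 * i + 2), cyc_mem_squareIndex (by omega) (by omega) (by omega) (by omega), ?_⟩
    rw [adapted_of_mod_three_ne (by omega) (by omega)]
    exact (BGA_pow_mul_Be_mul_Ga i).symm

lemma K22_subset (hk : 1 ≤ k) : K22 F k t c ⊆ σ '' squareIndex F k t c := by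
  rintro x ⟨i, ⟨hi, hi'⟩, rfl⟩
  obtain rfl | hik : i = k ∨ i < k := by omega
  · refine ⟨cyc 0 (3 * i), mem_squareIndex_cyc.2 ⟨mem_goodIndex_cyc.2 (by omega), fun _ ↦
      ⟨fun _ ↦ by omega, fun _ ↦ by omega⟩⟩, ?_⟩
    rw [adapted_socle, ← ABG_pow hi, ← GAB_pow hi]
  · refine ⟨cyc 2 (3 * i), cyc_mem_squareIndex (by omega) (by omega) (by omega) (by omega), ?_⟩
    rw [adapted_of_three_dvd (by omega) (by omega), ← ABG_pow hi, ← GAB_pow hi]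

lemma TT_subset (hk : 1 ≤ k) (ht : 3 ≤ t) (hkodd : Odd k) (htodd : Odd t) :
    TT F k t c ⊆ σ '' squareIndex F k t c := by
  rw [Nat.odd_iff] at hkodd htodd
  rintro x ((((((hx | hx) | hx) | hx) | ⟨i, ⟨hi, hi'⟩, rfl⟩) | ⟨j, ⟨hj, hj'⟩, rfl⟩) | hx)
  · exact B12_subset hk hx
  · exact B21_subset hk hx
  · exact K11_subset hk ht hx
  · exact K22_subset hk hx
  · refine ⟨cyc 0 (3 * i), cyc_mem_squareIndex (by omega) (by omega) (by omega) (by omega), ?_⟩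
    rw [adapted_zero (by omega)]
    exact (ABG_pow (by omega)).symm
  · exact ⟨loop j, mem_squareIndex_loop.2 (by omega), loopPath_of_pos (by omega)⟩
  · rw [NN] at hx
    split_ifs at hx with h
    · obtain rfl := hx
      refine ⟨cyc 0 1, mem_squareIndex_cyc.2 ⟨mem_goodIndex_cyc.2 (by omega), fun _ ↦
        ⟨fun _ ↦ by omega, fun _ ↦ h⟩⟩, ?_⟩
      rw [adapted_of_mod_three_ne (by omega) (by omega), cyclePath_one, arrow_zero]
    · exact hx.elim

lemma subset_TT (hk : 1 ≤ k) (ht : 3 ≤ t) : σ '' squareIndex F k t c ⊆ TT F k t c := by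
  have hB12 : B12 F k t c ⊆ TT F k t c := fun x hx ↦
    .inl <| .inl <| .inl <| .inl <| .inl <| .inl hx
  have hB21 : B21 F k t c ⊆ TT F k t c := fun x hx ↦
    .inl <| .inl <| .inl <| .inl <| .inl <| .inr hx
  have hK11 : K11 F k t c ⊆ TT F k t c := fun x hx ↦ .inl <| .inl <| .inl <| .inl <| .inr hx
  have hK22 : K22 F k t c ⊆ TT F k t c := fun x hx ↦ .inl <| .inl <| .inl <| .inr hx
  rintro _ ⟨⟨s, n⟩ | j, h, rfl⟩
  · obtain ⟨hg, h⟩ := mem_squareIndex_cyc.1 h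
    obtain ⟨hs, hn⟩ := mem_goodIndex_cyc.1 hg
    obtain ⟨i, rfl | rfl | rfl⟩ : ∃ i, n = 3 * i ∨ n = 3 * i + 1 ∨ n = 3 * i + 2 :=
      ⟨n / 3, by omega⟩
    · by_cases h0 : s = 0
      · obtain ⟨h, -⟩ := h h0
        subst h0
        obtain rfl | hik : i = k ∨ i ≠ k := by omega
        · rw [adapted_socle, ← ABG_pow (by omega), ← GAB_pow (by omega)]
          exact hK22 ⟨i, ⟨by omega, le_rfl⟩, rfl⟩
        · rw [adapted_zero (by omega), ← ABG_pow (by omega)]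
          exact .inl <| .inl <| .inr ⟨i, ⟨by omega, by omega⟩, rfl⟩
      · rw [adapted_of_three_dvd h0 (by omega), ← ABG_pow (by omega)]
        obtain rfl | rfl : s = 1 ∨ s = 2 := by omega
        · rw [← BGA_pow (by omega)]
          exact hK11 <| .inl <| .inl <| .inr ⟨i, ⟨by omega, by omega⟩, rfl⟩
        · rw [← GAB_pow (by omega)]
          exact hK22 ⟨i, ⟨by omega, by omega⟩, rfl⟩
    · rw [adapted_of_mod_three_ne (by omega) (by omega)]
      obtain rfl | rfl | rfl : s = 0 ∨ s = 1 ∨ s = 2 := by omega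
      · rw [← ABG_pow_mul_Al]
        obtain rfl | hi := Nat.eq_zero_or_pos i
        · refine .inr ?_
          rw [NN, if_pos ((h rfl).2 rfl)]
          simp
        · exact hK11 <| .inl <| .inr ⟨i, ⟨hi, by omega⟩, rfl⟩
      · rw [← BGA_pow_mul_Be]
        obtain rfl | hi := Nat.eq_zero_or_pos i
        · exact hB12 <| .inl <| .inl <| .inl (by simp)
        · exact hB12 <| .inl <| .inr ⟨i, ⟨hi, by omega⟩, rfl⟩
      · rw [← GAB_pow_mul_Ga]
        obtain rfl | hi := Nat.eq_zero_or_pos i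
        · exact hB21 <| .inl <| .inl <| .inl (by simp)
        · exact hB21 <| .inl <| .inr ⟨i, ⟨hi, by omega⟩, rfl⟩
    · by_cases h12 : s = 1 ∧ i = 0
      · obtain ⟨rfl, rfl⟩ := h12
        rw [mul_zero, zero_add, ← Be_mul_Ga_add_Ga_mul_Be ht]
        exact hK11 <| .inl <| .inl <| .inl rfl
      rw [adapted_of_mod_three_ne (by omega) (by omega)]
      obtain rfl | rfl | rfl : s = 0 ∨ s = 1 ∨ s = 2 := by omega
      · rw [← ABG_pow_mul_Al_mul_Be]
        obtain rfl | hi := Nat.eq_zero_or_pos i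
        · exact hB12 <| .inl <| .inl <| .inr (by simp)
        · exact hB12 <| .inr ⟨i, ⟨hi, by omega⟩, rfl⟩
      · rw [← BGA_pow_mul_Be_mul_Ga]
        exact hK11 <| .inr ⟨i, ⟨by omega, by omega⟩, rfl⟩
      · rw [← GAB_pow_mul_Ga_mul_Al]
        obtain rfl | hi := Nat.eq_zero_or_pos i
        · exact hB21 <| .inl <| .inl <| .inr (by simp)
        · exact hB21 <| .inr ⟨i, ⟨hi, by omega⟩, rfl⟩
  · obtain ⟨hj, hj'⟩ := mem_squareIndex_loop.1 h
    exact .inl <| .inr ⟨j, ⟨by omega, hj⟩, (loopPath_of_pos (by omega)).symm⟩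

lemma TT_eq (hk : 1 ≤ k) (ht : 3 ≤ t) (hkodd : Odd k) (htodd : Odd t) :
    TT F k t c = σ '' squareIndex F k t c :=
  (TT_subset hk ht hkodd htodd).antisymm (subset_TT hk ht)

end BasisSet

section Spanning

open PathIndex

variable {F k t c}

local notation "P" => cyclePath F k t c
local notation "L" => loopPath F k t c
local notation "ar" => arrow F k t c
local notation "ε" => triv F k t c
local notation "η" => Et F k t c
local notation "σ" => adapted F k t c

/-- Induction principle: a property of elements of the algebra that holds for scalars and
generators and is stable under sums and products holds everywhere. -/
lemma gen_induction {p : BA F k t c → Prop} (scalar : ∀ a : F, p (algebraMap F _ a))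
    (e1 : p (E1 F k t c)) (e2 : p (E2 F k t c)) (arr : ∀ r, p (ar r)) (et : p η)
    (add : ∀ x y, p x → p y → p (x + y)) (mul : ∀ x y, p x → p y → p (x * y)) (x) : p x := by
  obtain ⟨y, rfl⟩ := RingQuot.mkAlgHom_surjective F (Rel F k t c) x
  change p (mk F k t c y)
  induction y using FreeAlgebra.induction with
  | grade0 a => rw [AlgHom.commutes]; exact scalar a
  | grade1 g =>
    cases g with
    | e1 => exact e1
    | e2 => exact e2
    | a => exact arr 0
    | b => exact arr 1
    | g => exact arr 2
    | h => exact et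
  | mul x y hx hy => rw [map_mul]; exact mul _ _ hx hy
  | add x y hx hy => rw [map_add]; exact add _ _ hx hy

variable (F k t c) in
/-- The span of all paths. -/
def pathSpan : Submodule F (BA F k t c) :=
  Submodule.span F (Set.range (fun p : ℕ × ℕ ↦ P p.1 p.2) ∪ Set.range L)

lemma cyclePath_mem_pathSpan (n s : ℕ) : P n s ∈ pathSpan F k t c :=
  Submodule.subset_span (.inl ⟨(n, s), rfl⟩)

lemma loopPath_mem_pathSpan (j : ℕ) : L j ∈ pathSpan F k t c :=
  Submodule.subset_span (.inr ⟨j, rfl⟩)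

lemma triv_two : ε 2 = E2 F k t c := rfl

lemma triv_zero : ε 0 = E1 F k t c := rfl

lemma triv_mul_cyclePath_of_not (n : ℕ) {r s : ℕ} (h : ¬ (r % 3 = 2 ↔ s % 3 = 2)) :
    ε r * P n s = 0 := by
  rw [← triv_mul_cyclePath, ← mul_assoc, triv_mul_triv h, zero_mul]

lemma cyclePath_mul_triv_of_not (n : ℕ) {r s : ℕ} (h : ¬ (r % 3 = 2 ↔ (s + n) % 3 = 2)) :
    P n s * ε r = 0 := by
  rw [← cyclePath_mul_triv, mul_assoc, triv_mul_triv (by tauto), mul_zero]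

lemma triv_eq {r s : ℕ} (h : r % 3 = 2 ↔ s % 3 = 2) : ε r = ε s := by
  simp only [triv, h]

lemma arrow_mul_triv_eq_or (r s : ℕ) : ar r * ε s = ar r ∨ ar r * ε s = 0 := by
  by_cases h : s % 3 = 2 ↔ (r + 1) % 3 = 2
  · exact .inl (by rw [triv_eq h, arrow_mul_triv])
  · exact .inr (by rw [← cyclePath_one, cyclePath_mul_triv_of_not _ h])

lemma triv_mul_arrow_eq_or (r s : ℕ) : ε s * ar r = ar r ∨ ε s * ar r = 0 := by
  by_cases h : s % 3 = 2 ↔ r % 3 = 2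
  · exact .inl (by rw [triv_eq h, triv_mul_arrow])
  · exact .inr (by rw [← cyclePath_one, triv_mul_cyclePath_of_not _ h])

lemma triv_mul_cyclePath_mem (r n s : ℕ) : ε r * P n s ∈ pathSpan F k t c := by
  by_cases h : r % 3 = 2 ↔ s % 3 = 2
  · rw [triv_eq h, triv_mul_cyclePath]
    exact cyclePath_mem_pathSpan n s
  · rw [triv_mul_cyclePath_of_not n h]
    exact zero_mem _

lemma triv_mul_loopPath (r j : ℕ) : ε r * L j = if r % 3 = 2 then L j else 0 := by
  rw [loopPath, ← mul_assoc]
  split_ifs with h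
  · rw [triv_eq (s := 2) (by omega), triv_two, E2_mul_E2]
  · rw [← triv_two, triv_mul_triv (by omega), zero_mul]

lemma arrow_mul_arrow_mem (hk : 1 ≤ k) (r s : ℕ) : ar r * ar s ∈ pathSpan F k t c := by
  by_cases h : s % 3 = (r + 1) % 3
  · rw [arrow_congr h, arrow_mul_arrow]
    exact cyclePath_mem_pathSpan _ _
  by_cases h0 : r % 3 = 0 ∧ s % 3 = 0
  · rw [arrow_congr (r := 0) h0.1, arrow_congr (r := 0) h0.2, arrow_zero, Al_mul_Al' hk]
    exact Submodule.smul_mem _ _ (cyclePath_mem_pathSpan _ _)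
  by_cases h1 : r % 3 = 2 ∧ s % 3 = 1
  · rw [arrow_congr (r := 2) h1.1, arrow_congr (r := 1) h1.2, arrow_two, arrow_one, Ga_mul_Be]
    obtain h | h := Nat.eq_zero_or_pos (t - 1)
    · rw [h, pow_zero, ← E1_add_E2]
      exact add_mem (cyclePath_mem_pathSpan 0 0) (cyclePath_mem_pathSpan 0 2)
    · rw [← loopPath_of_pos h]
      exact loopPath_mem_pathSpan _
  · rw [arrow_mul_arrow_eq_zero h h0 h1]
    exact zero_mem _

lemma arrow_mul_cyclePath_mem (hk : 1 ≤ k) (ht : 3 ≤ t) (r n s : ℕ) :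
    ar r * P n s ∈ pathSpan F k t c := by
  obtain rfl | rfl | hn : n = 0 ∨ n = 1 ∨ 2 ≤ n := by omega
  · obtain h | h := arrow_mul_triv_eq_or (F := F) (k := k) (t := t) (c := c) r s
    · rw [cyclePath, h, ← cyclePath_one]
      exact cyclePath_mem_pathSpan _ _
    · rw [cyclePath, h]
      exact zero_mem _
  · rw [cyclePath_one]
    exact arrow_mul_arrow_mem hk r s
  · by_cases h : s % 3 = (r + 1) % 3
    · rw [arrow_mul_cyclePath n h]
      exact cyclePath_mem_pathSpan _ _
    · rw [arrow_mul_cyclePath_eq_zero hk ht h hn]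
      exact zero_mem _

lemma arrow_mul_loopPath_mem (hk : 1 ≤ k) (r j : ℕ) : ar r * L j ∈ pathSpan F k t c := by
  by_cases hr : r % 3 = 1
  · rw [arrow_congr (r := 1) hr, arrow_one, loopPath, ← mul_assoc, Be_mul_E2]
    obtain rfl | rfl | hj : j = 0 ∨ j = 1 ∨ 2 ≤ j := by omega
    · rw [pow_zero, mul_one, ← arrow_one, ← cyclePath_one]
      exact cyclePath_mem_pathSpan _ _
    · rw [pow_one, Be_mul_Et' hk]
      exact cyclePath_mem_pathSpan _ _
    · rw [Be_mul_Et_pow hj]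
      exact zero_mem _
  · rw [loopPath, ← mul_assoc, ← triv_two, ← cyclePath_one,
      cyclePath_mul_triv_of_not 1 (by omega), zero_mul]
    exact zero_mem _

lemma Et_mul_cyclePath_mem (hk : 1 ≤ k) (ht : 3 ≤ t) (n s : ℕ) :
    η * P n s ∈ pathSpan F k t c := by
  by_cases hs : s % 3 = 2
  · obtain rfl | rfl | hn : n = 0 ∨ n = 1 ∨ 2 ≤ n := by omega
    · rw [cyclePath, triv_eq (s := 2) (by omega), triv_two, Et_mul_E2, ← pow_one η,
        ← loopPath_of_pos le_rfl]
      exact loopPath_mem_pathSpan _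
    · rw [cyclePath_one, arrow_congr (r := 2) hs, arrow_two, Et_mul_Ga' hk]
      exact cyclePath_mem_pathSpan _ _
    · rw [Et_mul_cyclePath_eq_zero hk ht s hn]
      exact zero_mem _
  · rw [Et_mul_cyclePath_of_ne n hs]
    exact zero_mem _

lemma mul_mem_pathSpan_of_forall {x : BA F k t c} (h : ∀ n s, x * P n s ∈ pathSpan F k t c)
    (h' : ∀ j, x * L j ∈ pathSpan F k t c) {w : BA F k t c} (hw : w ∈ pathSpan F k t c) :
    x * w ∈ pathSpan F k t c := by
  induction hw using Submodule.span_induction with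
  | mem w hw =>
    obtain ⟨p, rfl⟩ | ⟨j, rfl⟩ := hw
    · exact h _ _
    · exact h' j
  | zero => rw [mul_zero]; exact zero_mem _
  | add y z _ _ hy hz => rw [mul_add]; exact add_mem hy hz
  | smul a y _ hy => rw [mul_smul_comm]; exact Submodule.smul_mem _ _ hy

lemma triv_mul_mem_pathSpan (r : ℕ) {w : BA F k t c} (hw : w ∈ pathSpan F k t c) :
    ε r * w ∈ pathSpan F k t c := by
  refine mul_mem_pathSpan_of_forall (triv_mul_cyclePath_mem r) (fun j ↦ ?_) hw
  rw [triv_mul_loopPath]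
  split_ifs
  · exact loopPath_mem_pathSpan j
  · exact zero_mem _

lemma mul_mem_pathSpan (hk : 1 ≤ k) (ht : 3 ≤ t) (x : BA F k t c) :
    ∀ w ∈ pathSpan F k t c, x * w ∈ pathSpan F k t c := by
  induction x using gen_induction with
  | scalar a =>
    intro w hw
    rw [← Algebra.smul_def]
    exact Submodule.smul_mem _ _ hw
  | e1 => exact fun w hw ↦ triv_mul_mem_pathSpan 0 hw
  | e2 => exact fun w hw ↦ triv_mul_mem_pathSpan 2 hw
  | arr r =>
    exact fun w ↦ mul_mem_pathSpan_of_forall (arrow_mul_cyclePath_mem hk ht r)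
      (arrow_mul_loopPath_mem hk r)
  | et =>
    exact fun w ↦ mul_mem_pathSpan_of_forall (Et_mul_cyclePath_mem hk ht)
      fun j ↦ by rw [Et_mul_loopPath]; exact loopPath_mem_pathSpan _
  | add x y hx hy => exact fun w hw ↦ by rw [add_mul]; exact add_mem (hx w hw) (hy w hw)
  | mul x y hx hy => exact fun w hw ↦ by rw [mul_assoc]; exact hx _ (hy w hw)

lemma pathSpan_eq_top (hk : 1 ≤ k) (ht : 3 ≤ t) : pathSpan F k t c = ⊤ := by
  refine eq_top_iff.2 fun x _ ↦ ?_
  rw [← mul_one x]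
  refine mul_mem_pathSpan hk ht x 1 ?_
  rw [← E1_add_E2]
  exact add_mem (cyclePath_mem_pathSpan 0 0) (cyclePath_mem_pathSpan 0 2)

lemma loopPath_mem_span (hk : 1 ≤ k) (ht : 3 ≤ t) (j : ℕ) :
    L j ∈ Submodule.span F (σ '' goodIndex k t) := by
  by_cases hj : j ≤ t
  · exact Submodule.subset_span ⟨loop j, hj, rfl⟩
  · rw [loopPath_of_pos (by omega), Et_pow_eq_zero hk ht (by omega)]
    exact zero_mem _

lemma cyclePath_zero_mem_span (hk : 1 ≤ k) (ht : 3 ≤ t) {n : ℕ} (hn : n ≤ 3 * k) :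
    P n 0 ∈ Submodule.span F (σ '' goodIndex k t) := by
  by_cases h : n = 3 * k
  · subst h
    have h1 : σ (cyc 0 (3 * k)) ∈ Submodule.span F (σ '' goodIndex k t) :=
      Submodule.subset_span ⟨_, mem_goodIndex_cyc.2 (by omega), rfl⟩
    rw [adapted_socle, cyclePath_socle_two hk ht, ← loopPath_of_pos (by omega)] at h1
    exact (Submodule.add_mem_iff_left _ (loopPath_mem_span hk ht t)).1 h1
  · rw [← adapted_zero h]
    exact Submodule.subset_span ⟨_, mem_goodIndex_cyc.2 (by omega), rfl⟩

lemma cyclePath_mem_span (hk : 1 ≤ k) (ht : 3 ≤ t) (n s : ℕ) :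
    P n s ∈ Submodule.span F (σ '' goodIndex k t) := by
  by_cases hn : 3 * k < n
  · rw [cyclePath_eq_zero hk ht s hn]
    exact zero_mem _
  rw [cyclePath_congr n (Nat.mod_mod s 3).symm]
  have hr : s % 3 < 3 := Nat.mod_lt _ (by omega)
  generalize s % 3 = r at hr
  by_cases h0 : r = 0
  · subst h0
    exact cyclePath_zero_mem_span hk ht (by omega)
  by_cases hn0 : n = 0
  · subst hn0
    obtain rfl | rfl : r = 1 ∨ r = 2 := by omega
    · exact cyclePath_zero_mem_span hk ht (Nat.zero_le _)
    · have h := loopPath_mem_span (F := F) (c := c) hk ht 0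
      rwa [loopPath, pow_zero, mul_one] at h
  by_cases hnk : n = 3 * k
  · subst hnk
    obtain rfl | rfl : r = 1 ∨ r = 2 := by omega
    · rw [cyclePath_socle_one hk]
      exact cyclePath_zero_mem_span hk ht le_rfl
    · rw [cyclePath_socle_two hk ht, ← loopPath_of_pos (by omega)]
      exact loopPath_mem_span hk ht t
  have h1 : σ (cyc r n) ∈ Submodule.span F (σ '' goodIndex k t) :=
    Submodule.subset_span ⟨_, mem_goodIndex_cyc.2 (by omega), rfl⟩
  by_cases h3 : n % 3 = 0
  · rw [adapted_of_three_dvd h0 h3] at h1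
    exact (Submodule.add_mem_iff_right _ (cyclePath_zero_mem_span hk ht (by omega))).1 h1
  by_cases h12 : r = 1 ∧ n = 2
  · obtain ⟨rfl, rfl⟩ := h12
    rw [adapted_one_two] at h1
    exact (Submodule.add_mem_iff_left _ (loopPath_mem_span hk ht _)).1 h1
  · rwa [adapted_of_mod_three_ne h3 h12] at h1

lemma span_adapted (hk : 1 ≤ k) (ht : 3 ≤ t) : Submodule.span F (σ '' goodIndex k t) = ⊤ := by
  rw [eq_top_iff, ← pathSpan_eq_top hk ht, pathSpan, Submodule.span_le]
  rintro _ (⟨p, rfl⟩ | ⟨j, rfl⟩)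
  · exact cyclePath_mem_span hk ht _ _
  · exact loopPath_mem_span hk ht j

end Spanning

open PathIndex

/-- The linear map on coordinates that induces the projection modulo commutators. -/
def traceCoord : (PathIndex →₀ F) →ₗ[F] (PathIndex →₀ F) :=
  linearCombination F fun
    | cyc s n =>
      if n % 3 = 0 then (if n < 3 * k then single (cyc 0 n) 1 else single (loop t) 1)
      else if s = 1 ∧ n = 2 then single (loop (t - 1)) 1 else 0
    | loop j => single (loop j) 1

section Trace

variable {F k t c}

/-- A linear map that vanishes on commutators. -/
def traceMap (hk : 1 ≤ k) (ht : 3 ≤ t) : BA F k t c →ₗ[F] (PathIndex →₀ F) :=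
  traceCoord F k t ∘ₗ coord hk ht

local notation "P" => cyclePath F k t c
local notation "L" => loopPath F k t c
local notation "ar" => arrow F k t c
local notation "ε" => triv F k t c
local notation "η" => Et F k t c
local notation "σ" => adapted F k t c

lemma traceMap_loopPath (hk : 1 ≤ k) (ht : 3 ≤ t) {j : ℕ} (hj : j ≤ t) :
    traceMap hk ht (L j) = single (loop j) 1 := by
  simp [traceMap, coord_loopPath, loopVec, hj, traceCoord]

lemma traceMap_cyclePath_of_mod_three_ne (hk : 1 ≤ k) (ht : 3 ≤ t) {n s : ℕ} (hn : n % 3 ≠ 0)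
    (h : ¬ (s % 3 = 1 ∧ n = 2)) : traceMap hk ht (P n s) = 0 := by
  rw [traceMap, LinearMap.comp_apply, coord_cyclePath, cycleVec, if_neg (by omega)]
  split_ifs <;> first | omega | simp [traceCoord, hn, h]

lemma traceMap_cyclePath_two_one (hk : 1 ≤ k) (ht : 3 ≤ t) :
    traceMap hk ht (P 2 1) = single (loop (t - 1)) 1 := by
  rw [traceMap, LinearMap.comp_apply, coord_cyclePath, cycleVec, if_neg (by omega),
    if_pos (by omega)]
  simp [traceCoord]

lemma traceMap_cyclePath_socle (hk : 1 ≤ k) (ht : 3 ≤ t) (s : ℕ) :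
    traceMap hk ht (P (3 * k) s) = single (loop t) 1 := by
  rw [traceMap, LinearMap.comp_apply, coord_cyclePath, cycleVec, if_neg (by omega),
    if_neg (by omega), if_pos rfl]
  split_ifs <;> simp [traceCoord]

lemma traceMap_cyclePath_of_three_dvd (hk : 1 ≤ k) (ht : 3 ≤ t) {n : ℕ} (s : ℕ) (hn : n % 3 = 0)
    (h : s % 3 ≠ 2 ∨ 1 ≤ n) (h' : n < 3 * k) :
    traceMap hk ht (P n s) = single (cyc 0 n) 1 := by
  rw [traceMap, LinearMap.comp_apply, coord_cyclePath, cycleVec]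
  obtain rfl | hn0 := Nat.eq_zero_or_pos n
  · rw [if_pos rfl, if_neg (by omega)]
    simp [traceCoord, show k ≠ 0 by omega]
  · rw [if_neg (by omega), if_pos h']
    simp [traceCoord, hn, h']

lemma traceMap_cyclePath_congr (hk : 1 ≤ k) (ht : 3 ≤ t) {n : ℕ} (s r : ℕ) (hn : n % 3 = 0)
    (h : 1 ≤ n) : traceMap hk ht (P n s) = traceMap hk ht (P n r) := by
  obtain h1 | rfl | h1 := lt_trichotomy n (3 * k)
  · rw [traceMap_cyclePath_of_three_dvd hk ht s hn (.inr h) h1,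
      traceMap_cyclePath_of_three_dvd hk ht r hn (.inr h) h1]
  · rw [traceMap_cyclePath_socle, traceMap_cyclePath_socle]
  · rw [cyclePath_eq_zero hk ht s h1, cyclePath_eq_zero hk ht r h1]

lemma traceMap_arrow (hk : 1 ≤ k) (ht : 3 ≤ t) (r : ℕ) : traceMap hk ht (ar r) = 0 := by
  rw [← cyclePath_one, traceMap_cyclePath_of_mod_three_ne hk ht (by omega) (by omega)]

lemma traceMap_triv_mul_cyclePath (hk : 1 ≤ k) (ht : 3 ≤ t) (r n s : ℕ) :
    traceMap hk ht (ε r * P n s) = traceMap hk ht (P n s * ε r) := by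
  by_cases h1 : r % 3 = 2 ↔ s % 3 = 2 <;> by_cases h2 : r % 3 = 2 ↔ (s + n) % 3 = 2
  · rw [triv_eq h1, triv_mul_cyclePath, ← triv_eq h1, triv_eq h2, cyclePath_mul_triv]
  · rw [triv_eq h1, triv_mul_cyclePath, ← triv_eq h1, cyclePath_mul_triv_of_not _ h2,
      traceMap_cyclePath_of_mod_three_ne hk ht (by omega) (by omega), map_zero]
  · rw [triv_eq h2, cyclePath_mul_triv, ← triv_eq h2, triv_mul_cyclePath_of_not _ h1,
      traceMap_cyclePath_of_mod_three_ne hk ht (by omega) (by omega), map_zero]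
  · rw [triv_mul_cyclePath_of_not _ h1, cyclePath_mul_triv_of_not _ h2]

lemma E2_mul_Et_pow_comm (j : ℕ) : Commute (E2 F k t c) (η ^ j) :=
  Commute.pow_right (show _ = _ by rw [E2_mul_Et, Et_mul_E2]) j

lemma loopPath_mul_triv (r j : ℕ) : L j * ε r = if r % 3 = 2 then L j else 0 := by
  rw [loopPath, E2_mul_Et_pow_comm, mul_assoc]
  split_ifs with h
  · rw [triv_eq (s := 2) (by omega), triv_two, E2_mul_E2]
  · rw [← triv_two, triv_mul_triv (by omega), mul_zero]

lemma loopPath_mul_Et (j : ℕ) : L j * η = η * L j := by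
  rw [loopPath, mul_assoc, ← pow_succ, ← mul_assoc, Et_mul_E2, ← pow_succ',
    ← loopPath, loopPath_of_pos (by omega)]

lemma traceMap_arrow_mul_arrow_of_eq (hk : 1 ≤ k) (ht : 3 ≤ t) {r s : ℕ}
    (h : s % 3 = (r + 1) % 3) :
    traceMap hk ht (ar r * ar s) = traceMap hk ht (ar s * ar r) := by
  rw [arrow_congr h, arrow_mul_arrow, ← arrow_congr h]
  by_cases h1 : r % 3 = 1
  · rw [cyclePath_congr (r := 1) 2 h1, traceMap_cyclePath_two_one,
      arrow_congr (s := s) (r := 2) (by omega), arrow_congr (r := 1) h1, arrow_one, arrow_two,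
      Ga_mul_Be, ← loopPath_of_pos (by omega), traceMap_loopPath hk ht (by omega)]
  · rw [traceMap_cyclePath_of_mod_three_ne hk ht (by omega) (by omega),
      arrow_mul_arrow_eq_zero (by omega) (by omega) (by omega), map_zero]

lemma traceMap_arrow_mul_cyclePath (hk : 1 ≤ k) (ht : 3 ≤ t) (r n s : ℕ) :
    traceMap hk ht (ar r * P n s) = traceMap hk ht (P n s * ar r) := by
  obtain rfl | rfl | hn : n = 0 ∨ n = 1 ∨ 2 ≤ n := by omega
  · rw [cyclePath]
    trans 0
    · obtain h | h := arrow_mul_triv_eq_or (F := F) (k := k) (t := t) (c := c) r s <;>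
        simp [h, traceMap_arrow]
    · obtain h | h := triv_mul_arrow_eq_or (F := F) (k := k) (t := t) (c := c) r s <;>
        simp [h, traceMap_arrow]
  · rw [cyclePath_one]
    obtain h | h | h : s % 3 = (r + 1) % 3 ∨ r % 3 = (s + 1) % 3 ∨ r % 3 = s % 3 := by omega
    · exact traceMap_arrow_mul_arrow_of_eq hk ht h
    · exact (traceMap_arrow_mul_arrow_of_eq hk ht h).symm
    · rw [arrow_congr h]
  · by_cases h1 : s % 3 = (r + 1) % 3 <;> by_cases h2 : r % 3 = (s + n) % 3
    · rw [arrow_mul_cyclePath n h1, cyclePath_mul_arrow n h2,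
        traceMap_cyclePath_congr hk ht r s (by omega) (by omega)]
    · rw [arrow_mul_cyclePath n h1, cyclePath_mul_arrow_eq_zero hk ht h2 hn,
        traceMap_cyclePath_of_mod_three_ne hk ht (by omega) (by omega), map_zero]
    · rw [arrow_mul_cyclePath_eq_zero hk ht h1 hn, cyclePath_mul_arrow n h2,
        traceMap_cyclePath_of_mod_three_ne hk ht (by omega) (by omega), map_zero]
    · rw [arrow_mul_cyclePath_eq_zero hk ht h1 hn, cyclePath_mul_arrow_eq_zero hk ht h2 hn]

lemma traceMap_arrow_mul_loopPath (hk : 1 ≤ k) (ht : 3 ≤ t) (r j : ℕ) :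
    traceMap hk ht (ar r * L j) = traceMap hk ht (L j * ar r) := by
  trans 0
  · by_cases hr : r % 3 = 1
    · rw [arrow_congr (r := 1) hr, arrow_one, loopPath, ← mul_assoc, Be_mul_E2]
      obtain rfl | rfl | hj : j = 0 ∨ j = 1 ∨ 2 ≤ j := by omega
      · rw [pow_zero, mul_one, ← arrow_one, traceMap_arrow]
      · rw [pow_one, Be_mul_Et' hk,
          traceMap_cyclePath_of_mod_three_ne hk ht (by omega) (by omega)]
      · rw [Be_mul_Et_pow hj, map_zero]
    · rw [loopPath, ← mul_assoc, ← triv_two, ← cyclePath_one,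
        cyclePath_mul_triv_of_not 1 (by omega), zero_mul, map_zero]
  · by_cases hr : r % 3 = 2
    · rw [arrow_congr (r := 2) hr, arrow_two, loopPath, E2_mul_Et_pow_comm, mul_assoc, E2_mul_Ga]
      obtain rfl | rfl | hj : j = 0 ∨ j = 1 ∨ 2 ≤ j := by omega
      · rw [pow_zero, one_mul, ← arrow_two, traceMap_arrow]
      · rw [pow_one, Et_mul_Ga' hk,
          traceMap_cyclePath_of_mod_three_ne hk ht (by omega) (by omega)]
      · rw [Et_pow_mul_Ga hj, map_zero]
    · rw [loopPath, E2_mul_Et_pow_comm, mul_assoc, ← triv_two, ← cyclePath_one,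
        triv_mul_cyclePath_of_not 1 (by omega), mul_zero, map_zero]

lemma traceMap_Et_mul_cyclePath (hk : 1 ≤ k) (ht : 3 ≤ t) (n s : ℕ) :
    traceMap hk ht (η * P n s) = traceMap hk ht (P n s * η) := by
  obtain rfl | rfl | hn : n = 0 ∨ n = 1 ∨ 2 ≤ n := by omega
  · by_cases hs : s % 3 = 2
    · rw [cyclePath, triv_eq (s := 2) (by omega), triv_two, Et_mul_E2, E2_mul_Et]
    · rw [cyclePath, Et_mul_triv hs, triv_mul_Et hs]
  · have h := traceMap_arrow_mul_loopPath (F := F) (c := c) hk ht s 1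
    rw [loopPath_of_pos le_rfl, pow_one] at h
    rw [cyclePath_one, h]
  · rw [Et_mul_cyclePath_eq_zero hk ht s hn, cyclePath_mul_Et_eq_zero hk ht s hn]

lemma traceMap_mul_comm_of_forall (hk : 1 ≤ k) (ht : 3 ≤ t) {x : BA F k t c}
    (h : ∀ n s, traceMap hk ht (x * P n s) = traceMap hk ht (P n s * x))
    (h' : ∀ j, traceMap hk ht (x * L j) = traceMap hk ht (L j * x)) (w : BA F k t c) :
    traceMap hk ht (x * w) = traceMap hk ht (w * x) := by
  have hw : w ∈ pathSpan F k t c := by rw [pathSpan_eq_top hk ht]; trivial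
  induction hw using Submodule.span_induction with
  | mem w hw =>
    obtain ⟨p, rfl⟩ | ⟨j, rfl⟩ := hw
    · exact h _ _
    · exact h' j
  | zero => rw [mul_zero, zero_mul]
  | add y z _ _ hy hz => rw [mul_add, add_mul, map_add, map_add, hy, hz]
  | smul a y _ hy => rw [mul_smul_comm, smul_mul_assoc, map_smul, map_smul, hy]

lemma traceMap_mul_comm (hk : 1 ≤ k) (ht : 3 ≤ t) (x : BA F k t c) :
    ∀ w, traceMap hk ht (x * w) = traceMap hk ht (w * x) := by
  induction x using gen_induction with
  | scalar a => exact fun w ↦ by rw [Algebra.commutes]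
  | e1 =>
    exact traceMap_mul_comm_of_forall hk ht (traceMap_triv_mul_cyclePath hk ht 0) fun j ↦ by
      rw [← triv_zero, triv_mul_loopPath, loopPath_mul_triv]
  | e2 =>
    exact traceMap_mul_comm_of_forall hk ht (traceMap_triv_mul_cyclePath hk ht 2) fun j ↦ by
      rw [← triv_two, triv_mul_loopPath, loopPath_mul_triv]
  | arr r =>
    exact traceMap_mul_comm_of_forall hk ht (traceMap_arrow_mul_cyclePath hk ht r)
      (traceMap_arrow_mul_loopPath hk ht r)
  | et =>
    exact traceMap_mul_comm_of_forall hk ht (traceMap_Et_mul_cyclePath hk ht) fun j ↦ by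
      rw [loopPath_mul_Et]
  | add x y hx hy => exact fun w ↦ by rw [add_mul, mul_add, map_add, map_add, hx, hy]
  | mul x y hx hy => exact fun w ↦ by rw [mul_assoc, hx, mul_assoc, hy, mul_assoc]

lemma traceMap_eq_zero_of_mem_Kspan (hk : 1 ≤ k) (ht : 3 ≤ t) {x : BA F k t c}
    (hx : x ∈ Kspan F (BA F k t c)) : traceMap hk ht x = 0 := by
  suffices h : Kspan F (BA F k t c) ≤ LinearMap.ker (traceMap hk ht) from h hx
  refine Submodule.span_le.2 ?_
  rintro _ ⟨u, v, rfl⟩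
  simp [traceMap_mul_comm hk ht u v]

end Trace

section SquareInCommutators

variable {F} {A : Type} [Ring A] [Algebra F A]

lemma commutator_mem_Kspan (u v : A) : u * v - v * u ∈ Kspan F A :=
  Submodule.subset_span ⟨u, v, rfl⟩

variable (F) in
lemma add_self_eq_zero_of_algebra [CharP F 2] (x : A) : x + x = 0 := by
  rw [← two_smul F x, CharTwo.two_eq_zero, zero_smul]

variable (F) in
lemma add_eq_sub_of_algebra [CharP F 2] (x y : A) : x + y = x - y := by
  rw [eq_sub_iff_add_eq, add_assoc, add_self_eq_zero_of_algebra F y, add_zero]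

lemma add_sq_sub_mem_Kspan [CharP F 2] (x y : A) : (x + y) ^ 2 - (x ^ 2 + y ^ 2) ∈ Kspan F A := by
  have h : (x + y) ^ 2 - (x ^ 2 + y ^ 2) = x * y + y * x := by noncomm_ring
  rw [h, add_eq_sub_of_algebra F]
  exact commutator_mem_Kspan x y

variable (F A) in
/-- The subspace of elements whose squares lie in the commutator subspace. -/
def squareSubmodule [CharP F 2] : Submodule F A where
  carrier := {x | x ^ 2 ∈ Kspan F A}
  zero_mem' := by simp
  add_mem' {x y} hx hy := by
    have h := add_mem (add_sq_sub_mem_Kspan (F := F) x y) (add_mem hx hy)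
    rwa [sub_add_cancel] at h
  smul_mem' a x hx := by
    change (a • x) ^ 2 ∈ Kspan F A
    rw [smul_pow]
    exact Submodule.smul_mem _ _ hx

lemma Kspan_le_squareSubmodule [CharP F 2] : Kspan F A ≤ squareSubmodule F A := by
  refine Submodule.span_le.2 ?_
  rintro _ ⟨u, v, rfl⟩
  have h : (u * v - v * u) ^ 2 = (u * (v * u * v) - v * u * v * u)
      - ((u * v) * (v * u) - (v * u) * (u * v))
      + (v * u * v * u + v * u * v * u) - (v * u * (u * v) + v * u * (u * v)) := by noncomm_ring
  change (u * v - v * u) ^ 2 ∈ Kspan F A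
  rw [h, add_self_eq_zero_of_algebra F, add_self_eq_zero_of_algebra F, add_zero, sub_zero]
  exact sub_mem (commutator_mem_Kspan _ _) (commutator_mem_Kspan _ _)

end SquareInCommutators

section Squares

open PathIndex

variable {F k t c}

local notation "P" => cyclePath F k t c
local notation "L" => loopPath F k t c
local notation "ar" => arrow F k t c
local notation "ε" => triv F k t c
local notation "η" => Et F k t c
local notation "σ" => adapted F k t c
local notation "K" => Kspan F (BA F k t c)

lemma mem_Kspan_of_mul_eq_zero {x y : BA F k t c} (h : y * x = 0) : x * y ∈ K := by
  have := commutator_mem_Kspan (F := F) x y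
  rwa [h, sub_zero] at this

lemma cyclePath_mem_Kspan (hk : 1 ≤ k) (ht : 3 ≤ t) {n s : ℕ} (hn : n % 3 ≠ 0)
    (h1 : n = 1 → s % 3 ≠ 0) (h2 : n = 2 → s % 3 ≠ 1) : P n s ∈ K := by
  obtain rfl | rfl | h3 : n = 1 ∨ n = 2 ∨ 3 ≤ n := by omega
  · rw [← cyclePath_mul_triv]
    exact mem_Kspan_of_mul_eq_zero (triv_mul_cyclePath_of_not _ (by omega))
  · rw [← arrow_mul_arrow]
    exact mem_Kspan_of_mul_eq_zero (arrow_mul_arrow_eq_zero (by omega) (by omega) (by omega))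
  · obtain ⟨m, rfl⟩ := Nat.exists_eq_add_of_le' (show 1 ≤ n by omega)
    rw [← cyclePath_mul_arrow m rfl]
    exact mem_Kspan_of_mul_eq_zero (arrow_mul_cyclePath_eq_zero hk ht (by omega) (by omega))

lemma cyclePath_sub_succ_mem_Kspan {n : ℕ} (s : ℕ) (hn : n % 3 = 0) (h : 1 ≤ n) :
    P n s - P n (s + 1) ∈ K := by
  obtain ⟨m, rfl⟩ := Nat.exists_eq_add_of_le' h
  rw [← arrow_mul_cyclePath m rfl, ← cyclePath_mul_arrow m (r := s) (by omega)]
  exact commutator_mem_Kspan _ _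

lemma cyclePath_sub_mem_Kspan {n : ℕ} (s : ℕ) (hn : n % 3 = 0) (h : 1 ≤ n) :
    P n 0 - P n s ∈ K := by
  induction s with
  | zero => rw [sub_self]; exact zero_mem _
  | succ s ih =>
    have := add_mem ih (cyclePath_sub_succ_mem_Kspan (F := F) (k := k) (t := t) (c := c) s hn h)
    rwa [sub_add_sub_cancel] at this

lemma loopPath_sq {j : ℕ} (hj : 1 ≤ j) : L j ^ 2 = η ^ (2 * j) := by
  rw [loopPath_of_pos hj, ← pow_mul, mul_comm]

lemma cyclePath_sq {n : ℕ} (s : ℕ) (hn : n % 3 = 0) : P n s ^ 2 = P (2 * n) s := by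
  rw [sq, cyclePath_mul_cyclePath n n (by omega), two_mul]

lemma adapted_sq_mem_Kspan [CharP F 2] (hk : 1 ≤ k) (ht : 3 ≤ t) {i : PathIndex}
    (hi : i ∈ squareIndex F k t c) : σ i ^ 2 ∈ K := by
  have hK : K ≤ squareSubmodule F (BA F k t c) := Kspan_le_squareSubmodule
  rcases i with ⟨s, n⟩ | j
  · obtain ⟨hg, h⟩ := mem_squareIndex_cyc.1 hi
    obtain ⟨hs, hn⟩ := mem_goodIndex_cyc.1 hg
    by_cases h3 : n % 3 = 0
    · by_cases h0 : s = 0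
      · obtain ⟨h, -⟩ := h h0
        subst h0
        by_cases hnk : n = 3 * k
        · subst hnk
          refine hK ?_
          rw [adapted_socle, add_eq_sub_of_algebra F]
          exact cyclePath_sub_mem_Kspan 2 h3 (by omega)
        · rw [adapted_zero hnk, cyclePath_sq 0 h3, cyclePath_eq_zero hk ht 0 (by omega)]
          exact zero_mem _
      · refine hK ?_
        rw [adapted_of_three_dvd h0 h3, add_eq_sub_of_algebra F]
        exact cyclePath_sub_mem_Kspan s h3 (by omega)
    by_cases h12 : s = 1 ∧ n = 2
    · obtain ⟨rfl, rfl⟩ := h12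
      refine hK ?_
      rw [← Be_mul_Ga_add_Ga_mul_Be ht, add_eq_sub_of_algebra F]
      exact commutator_mem_Kspan _ _
    rw [adapted_of_mod_three_ne h3 h12]
    by_cases h01 : s = 0 ∧ n = 1
    · obtain ⟨rfl, rfl⟩ := h01
      rw [cyclePath_one, arrow_zero, sq, Al_mul_Al' hk, (h rfl).2 rfl, zero_smul]
      exact zero_mem _
    · exact hK (cyclePath_mem_Kspan hk ht h3 (by omega) (by omega))
  · obtain ⟨hj, hj'⟩ := mem_squareIndex_loop.1 hi
    rw [adapted, loopPath_sq (by omega), Et_pow_eq_zero hk ht hj']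
    exact zero_mem _

/-- The index of the class of the square of an adapted basis vector modulo commutators. -/
def squareTarget (t : ℕ) : PathIndex → PathIndex
  | cyc _ n => if n = 1 then loop t else cyc 0 (2 * n)
  | loop j => loop (2 * j)

lemma not_mem_squareIndex_cases (hkodd : Odd k) (htodd : Odd t) {i : PathIndex}
    (hi : i ∈ goodIndex k t) (hi' : i ∉ squareIndex F k t c) :
    (i = cyc 0 1 ∧ c ≠ 0) ∨ (∃ n, i = cyc 0 n ∧ n % 3 = 0 ∧ 2 * n < 3 * k) ∨
      ∃ j, i = loop j ∧ 2 * j < t := by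
  rw [Nat.odd_iff] at hkodd htodd
  rcases i with ⟨s, n⟩ | j
  · rw [mem_squareIndex_cyc, not_and, not_forall] at hi'
    obtain ⟨rfl, h⟩ := hi' hi
    by_cases h1 : n = 1
    · subst h1
      refine .inl ⟨rfl, fun hc ↦ h ⟨by omega, fun _ ↦ hc⟩⟩
    · by_cases h3 : n % 3 = 0 ∧ 2 * n ≤ 3 * k
      · exact .inr <| .inl ⟨n, rfl, h3.1, by omega⟩
      · exact absurd ⟨by omega, fun h ↦ absurd h h1⟩ h
  · rw [mem_squareIndex_loop] at hi'
    rw [mem_goodIndex_loop] at hi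
    exact .inr <| .inr ⟨j, rfl, by omega⟩

lemma squareTarget_injOn (hkodd : Odd k) (htodd : Odd t) {i j : PathIndex}
    (hi : i ∈ goodIndex k t) (hi' : i ∉ squareIndex F k t c)
    (hj : j ∈ goodIndex k t) (hj' : j ∉ squareIndex F k t c)
    (h : squareTarget t i = squareTarget t j) : i = j := by
  obtain ⟨rfl, -⟩ | ⟨n, rfl, hn, -⟩ | ⟨n, rfl, hn⟩ :=
    not_mem_squareIndex_cases hkodd htodd hi hi' <;>
  obtain ⟨rfl, -⟩ | ⟨m, rfl, hm, -⟩ | ⟨m, rfl, hm⟩ :=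
    not_mem_squareIndex_cases hkodd htodd hj hj' <;>
  simp only [squareTarget] at h ⊢ <;> (try split_ifs at h) <;> simp at h ⊢ <;> omega

lemma traceMap_adapted_sq (hk : 1 ≤ k) (ht : 3 ≤ t) (hkodd : Odd k) (htodd : Odd t)
    {i : PathIndex} (hi : i ∈ goodIndex k t) (hi' : i ∉ squareIndex F k t c) :
    ∃ a : F, a ≠ 0 ∧ traceMap hk ht (σ i ^ 2) = single (squareTarget t i) a := by
  obtain ⟨rfl, hc⟩ | ⟨n, rfl, hn, hn'⟩ | ⟨n, rfl, hn⟩ :=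
    not_mem_squareIndex_cases hkodd htodd hi hi'
  · refine ⟨c, hc, ?_⟩
    rw [adapted_zero (by omega), cyclePath_one, arrow_zero, sq, Al_mul_Al' hk, map_smul,
      traceMap_cyclePath_socle]
    simp [squareTarget]
  · refine ⟨1, one_ne_zero, ?_⟩
    rw [adapted_zero (by omega), cyclePath_sq 0 hn,
      traceMap_cyclePath_of_three_dvd hk ht 0 (by omega) (by omega) hn', squareTarget,
      if_neg (by omega)]
  · refine ⟨1, one_ne_zero, ?_⟩
    have h : L n ^ 2 = L (2 * n) := by
      obtain rfl | h := Nat.eq_zero_or_pos n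
      · rw [mul_zero, loopPath, pow_zero, mul_one, sq, E2_mul_E2]
      · rw [loopPath_sq h, loopPath_of_pos (by omega)]
    rw [adapted, h, traceMap_loopPath hk ht hn.le]
    rfl

/-- In characteristic two, squaring followed by the trace map is additive. -/
def squareTrace [CharP F 2] (hk : 1 ≤ k) (ht : 3 ≤ t) : BA F k t c →+ (PathIndex →₀ F) where
  toFun x := traceMap hk ht (x ^ 2)
  map_zero' := by simp
  map_add' x y := by
    rw [← map_add, ← sub_eq_zero, ← map_sub]
    exact traceMap_eq_zero_of_mem_Kspan hk ht (add_sq_sub_mem_Kspan x y)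

lemma squareTrace_smul [CharP F 2] (hk : 1 ≤ k) (ht : 3 ≤ t) (a : F) (x : BA F k t c) :
    squareTrace hk ht (a • x) = a ^ 2 • squareTrace hk ht x := by
  change traceMap hk ht ((a • x) ^ 2) = a ^ 2 • traceMap hk ht (x ^ 2)
  rw [smul_pow, map_smul]

lemma mem_span_of_sq_mem_Kspan [CharP F 2] (hk : 1 ≤ k) (ht : 3 ≤ t) (hkodd : Odd k)
    (htodd : Odd t) {x : BA F k t c} (hx : x ^ 2 ∈ K) :
    x ∈ Submodule.span F (σ '' squareIndex F k t c) := by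
  have hx' : x ∈ Submodule.span F (σ '' goodIndex k t) := by rw [span_adapted hk ht]; trivial
  obtain ⟨l, hl, rfl⟩ := (Finsupp.mem_span_image_iff_linearCombination F).1 hx'
  rw [Finsupp.mem_supported] at hl
  refine (Finsupp.mem_span_image_iff_linearCombination F).2 ⟨l, ?_, rfl⟩
  rw [Finsupp.mem_supported]
  intro i hi
  by_contra hi'
  have h0 : squareTrace hk ht (linearCombination F σ l) = 0 :=
    traceMap_eq_zero_of_mem_Kspan hk ht hx
  rw [linearCombination_apply, Finsupp.sum, map_sum] at h0
  have h1 := DFunLike.congr_fun h0 (squareTarget t i)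
  rw [Finsupp.finsetSum_apply, Finset.sum_eq_single i] at h1
  · obtain ⟨a, ha, h⟩ := traceMap_adapted_sq (F := F) hk ht hkodd htodd (hl hi) hi'
    have h2 : squareTrace hk ht (σ i) = single (squareTarget t i) a := h
    rw [squareTrace_smul, h2] at h1
    simp [ha] at h1
    exact (Finsupp.mem_support_iff.1 hi) h1
  · intro j hj hji
    rw [squareTrace_smul]
    by_cases hj' : j ∈ squareIndex F k t c
    · have h2 : squareTrace hk ht (σ j) = 0 :=
        traceMap_eq_zero_of_mem_Kspan hk ht (adapted_sq_mem_Kspan hk ht hj')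
      rw [h2, smul_zero]; rfl
    · obtain ⟨a, -, h⟩ := traceMap_adapted_sq (F := F) hk ht hkodd htodd (hl hj) hj'
      have h2 : squareTrace hk ht (σ j) = single (squareTarget t j) a := h
      rw [h2, Finsupp.smul_apply, Finsupp.single_eq_of_ne, smul_zero]
      exact fun h3 ↦ hji (squareTarget_injOn hkodd htodd (hl hj) hj' (hl hi) hi' h3.symm)
  · exact fun h ↦ absurd hi h

end Squares

/-- **Lemma 5.3 (basis of `T₁(B^{k,t}_c)`, semidihedral type, second family).**
For `k ≥ 1` and `t ≥ 3` both odd and `c ∈ {0,1}` the set 𝓣 is an F-basis of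
`T₁(B^{k,t}_c) = {x : x² ∈ K(B^{k,t}_c)}`. -/
theorem semidihedral_two_T1_basis
    (F : Type) [Field F] [IsAlgClosed F] [CharP F 2]
    (k t : ℕ) (hk : 1 ≤ k) (ht : 3 ≤ t) (hkodd : Odd k) (htodd : Odd t)
    (c : F) (hc : c = 0 ∨ c = 1) :
    LinearIndependent F (fun p : (TT F k t c) => (p : BA F k t c)) ∧
    (Submodule.span F (TT F k t c) : Set (BA F k t c)) = T1set F k t c := by
  rw [TT_eq hk ht hkodd htodd]
  refine ⟨?_, Set.Subset.antisymm ?_ fun x hx ↦ mem_span_of_sq_mem_Kspan hk ht hkodd htodd hx⟩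
  · exact ((linearIndepOn_adapted hk ht).mono fun i hi ↦ hi.1).id_image
  · have h : Submodule.span F (adapted F k t c '' squareIndex F k t c) ≤
        squareSubmodule F (BA F k t c) := by
      refine Submodule.span_le.2 ?_
      rintro _ ⟨i, hi, rfl⟩
      exact adapted_sq_mem_Kspan hk ht hi
    exact h

end SD2Paper

end
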